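/- There exists a constant c > 0, depending only on d and κ, such that for all integers n ≥ 1 and all x, y ∈ T^d the projection kernel satisfies |P_n(W_κ^T;x,y)| ≤ c n^{(d−1)/2} (‖ξ − ζ‖ + n^{−1})^{−(d−1)/2} ∏_{j=1}^{d+1}(√(x_j y_j) + n^{−1}‖ξ − ζ‖ + n^{−2})^{−κ_j}. -/

import Mathlib

open MeasureTheory Finset Real intervalIntegral

/-- Generalized binomial coefficient `C(x, k) = x (x-1) ⋯ (x-k+1) / k!`. -/
noncomputable def genBinom (x : ℝ) (k : ℕ) : ℝ :=
  (∏ i ∈ Finset.range k, (x - i)) / (Nat.factorial k)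

/-- Cesàro coefficient `A_m^δ = C(m+δ, m)`. -/
noncomputable def cesA (δ : ℝ) (m : ℕ) : ℝ := genBinom (m + δ) m

/-- The cube `[-1,1]^m`. -/
def cube (m : ℕ) : Set (Fin m → ℝ) := Set.univ.pi fun _ => Set.Icc (-1) 1

/-- The simplex `T^d = {x : x_i ≥ 0, Σ x_i ≤ 1}`. -/
def simplexT (d : ℕ) : Set (Fin d → ℝ) := {x | (∀ i, 0 ≤ x i) ∧ ∑ i, x i ≤ 1}

/-- The Jacobi weight `w^{(α,β)}(t) = (1-t)^α (1+t)^β`. -/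
noncomputable def wJac (a b t : ℝ) : ℝ := (1 - t) ^ a * (1 + t) ^ b

/-- Extended coordinates: `(x_1, …, x_d, 1 - |x|)`. -/
noncomputable def xext (d : ℕ) (x : Fin d → ℝ) : Fin (d + 1) → ℝ := fun i =>
  if h : (i : ℕ) < d then x ⟨i, h⟩ else 1 - ∑ j, x j

/-- `z(x,y,t) = Σ_j √(x_j y_j) t_j` with the extended coordinates. -/
noncomputable def zST (d : ℕ) (x y : Fin d → ℝ) (t : Fin (d + 1) → ℝ) : ℝ :=
  ∑ j, Real.sqrt (xext d x j * xext d y j) * t j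

/-- The Euclidean distance `‖ξ - ζ‖` between `ξ = (√x_1,…,√x_{d+1})` and
`ζ = (√y_1,…,√y_{d+1})`. -/
noncomputable def distXi (d : ℕ) (x y : Fin d → ℝ) : ℝ :=
  Real.sqrt (∑ j, (Real.sqrt (xext d x j) - Real.sqrt (xext d y j)) ^ 2)

/-- The weight `∏ (1-t_i²)^{κ_i-1}` on the cube `[-1,1]^{d+1}`. -/
noncomputable def wcube {m : ℕ} (κ : Fin m → ℝ) (t : Fin m → ℝ) : ℝ :=
  ∏ i, (1 - t i ^ 2) ^ (κ i - 1)

/-- The Cesàro `(C,δ)` kernel `K_n^δ(W_κ^T; x, y)` on the simplex, built from the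
orthonormal Jacobi family `q = (q_k^{(|κ|+(d-2)/2, -1/2)})`. -/
noncomputable def simpK (d : ℕ) (κ : Fin (d + 1) → ℝ) (q : ℕ → Polynomial ℝ) (δ : ℝ)
    (n : ℕ) (x y : Fin d → ℝ) : ℝ :=
  (∫ t in cube (d + 1), wcube κ t)⁻¹ *
    ∫ t in cube (d + 1),
      ((cesA δ n)⁻¹ * ∑ k ∈ Finset.range (n + 1),
        cesA δ (n - k) * (q k).eval 1 * (q k).eval (2 * zST d x y t ^ 2 - 1)) * wcube κ t

/-- The projection kernel `P_n(W_κ^T; x, y)` on the simplex. -/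
noncomputable def simpP (d : ℕ) (κ : Fin (d + 1) → ℝ) (q : ℕ → Polynomial ℝ)
    (n : ℕ) (x y : Fin d → ℝ) : ℝ :=
  (∫ t in cube (d + 1), wcube κ t)⁻¹ *
    ∫ t in cube (d + 1),
      ((q n).eval 1 * (q n).eval (2 * zST d x y t ^ 2 - 1)) * wcube κ t

/-- The weight `W_κ^T(x) = ∏ x_i^{κ_i-1/2} (1-|x|)^{κ_{d+1}-1/2}` on the simplex. -/
noncomputable def WT (d : ℕ) (κ : Fin (d + 1) → ℝ) (x : Fin d → ℝ) : ℝ :=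
  (∏ i : Fin d, x i ^ (κ i.castSucc - 1 / 2)) * (1 - ∑ i, x i) ^ (κ (Fin.last d) - 1 / 2)

/-- `σ_κ = (d-1)/2 + |κ| - min_i κ_i`. -/
noncomputable def sigmaK (d : ℕ) (κ : Fin (d + 1) → ℝ) : ℝ :=
  ((d : ℝ) - 1) / 2 + (∑ i, κ i) - Finset.univ.inf' (Finset.univ_nonempty) κ

section Gegenbauer

open Polynomial

/-- The Gegenbauer (ultraspherical) polynomials `C_m^l`. -/
noncomputable def gegen (l : ℝ) : ℕ → ℝ[X]
  | 0 => 1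
  | 1 => C (2 * l) * X
  | (m + 2) => C ((m + 2 : ℝ)⁻¹) *
      (C (2 * (m + 1 + l)) * X * gegen l (m + 1) - C (m + 2 * l) * gegen l m)

theorem gegen_rec (l : ℝ) (m : ℕ) :
    C (m + 2 : ℝ) * gegen l (m + 2) =
      C (2 * (m + 1 + l)) * X * gegen l (m + 1) - C (m + 2 * l) * gegen l m := by
  have h : (m + 2 : ℝ) ≠ 0 := by positivity
  rw [gegen, ← mul_assoc, ← C_mul, mul_inv_cancel₀ h, C_1, one_mul]

theorem gegen_derivative_rec (l : ℝ) (m : ℕ) :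
    derivative (gegen l (m + 1)) = X * derivative (gegen l m) + C (m + 2 * l) * gegen l m ∧
    X * derivative (gegen l (m + 1)) - derivative (gegen l m) =
      C (m + 1 : ℝ) * gegen l (m + 1) := by
  induction m with
  | zero => simp [gegen, mul_comm]
  | succ m ih =>
    obtain ⟨ha, hb⟩ := ih
    have hm : (C (m + 2 : ℝ) : ℝ[X]) ≠ 0 := by
      rw [Ne, C_eq_zero]; positivity
    have hrec := gegen_rec l m
    have hd := congrArg derivative hrec
    simp only [derivative_mul, derivative_sub, derivative_C, derivative_X] at hd
    have ha' : derivative (gegen l (m + 2)) =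
        X * derivative (gegen l (m + 1)) + C ((m + 1 : ℕ) + 2 * l) * gegen l (m + 1) := by
      apply mul_left_cancel₀ hm
      push_cast
      simp only [C_add, C_mul, map_natCast, map_ofNat, C_1] at *
      linear_combination hd + ((m : ℝ[X]) + 2 * C l) * hb
    refine ⟨ha', ?_⟩
    rw [show m + 1 + 1 = m + 2 from rfl, ha']
    push_cast
    simp only [C_add, C_mul, map_natCast, map_ofNat, C_1] at *
    linear_combination -hrec - ha + X * hb

theorem gegen_ode (l : ℝ) (m : ℕ) :
    (1 - X ^ 2) * derivative (derivative (gegen l m)) - C (2 * l + 1) * X * derivative (gegen l m) +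
      C (m * (m + 2 * l)) * gegen l m = 0 := by
  cases m with
  | zero => simp [gegen]
  | succ m =>
    obtain ⟨ha, hb⟩ := gegen_derivative_rec l m
    have hc : (1 - X ^ 2) * derivative (gegen l (m + 1)) =
        C (m + 2 * l) * gegen l m - C (m + 1 : ℝ) * X * gegen l (m + 1) := by
      linear_combination ha - X * hb
    have hd := congrArg derivative hc
    simp only [derivative_mul, derivative_sub, derivative_C, derivative_X, derivative_X_pow,
      derivative_one] at hd
    push_cast at *
    simp only [C_add, C_mul, map_natCast, map_ofNat, C_1] at *
    linear_combination hd - ((m : ℝ[X]) + 2 * C l) * hb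

theorem gegen_eval_one_succ (l : ℝ) (m : ℕ) :
    (m + 1 : ℝ) * (gegen l (m + 1)).eval 1 = (m + 2 * l) * (gegen l m).eval 1 := by
  obtain ⟨ha, hb⟩ := gegen_derivative_rec l m
  have ha' := congrArg (eval 1) ha
  have hb' := congrArg (eval 1) hb
  simp at ha' hb'
  linarith

theorem gegen_eval_one_pos {l : ℝ} (hl : 0 < l) (m : ℕ) : 0 < (gegen l m).eval 1 := by
  induction m with
  | zero => simp [gegen]
  | succ m ih =>
    have h := gegen_eval_one_succ l m
    have : 0 < (m + 1 : ℝ) * (gegen l (m + 1)).eval 1 := by rw [h]; positivity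
    exact pos_of_mul_pos_right this (by positivity)

theorem gegen_natDegree_le (l : ℝ) (m : ℕ) : (gegen l m).natDegree ≤ m := by
  induction m using Nat.twoStepInduction with
  | zero => simp [gegen]
  | one => rw [gegen]; exact (natDegree_C_mul_le _ _).trans natDegree_X_le
  | more m h0 h1 =>
    rw [gegen]
    refine (natDegree_C_mul_le _ _).trans ((natDegree_sub_le _ _).trans (max_le ?_ ?_))
    · rw [mul_assoc]
      refine (natDegree_C_mul_le _ _).trans (natDegree_mul_le.trans ?_)
      rw [natDegree_X]; omega
    · exact (natDegree_C_mul_le _ _).trans (by omega)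

end Gegenbauer

section UltrasphericalWeight

open Polynomial

theorem intervalIntegrable_one_sub_sq_rpow {a : ℝ} (ha : -1 < a) :
    IntervalIntegrable (fun t : ℝ => (1 - t ^ 2) ^ a) volume (-1) 1 := by
  have h01 : IntervalIntegrable (fun t : ℝ => (1 - t ^ 2) ^ a) volume 0 1 := by
    have h1 : IntervalIntegrable (fun t : ℝ => (1 - t) ^ a) volume 0 1 := by
      have := (intervalIntegral.intervalIntegrable_rpow' (a := 0) (b := 1) ha).comp_sub_left 1
      simpa using this.symm
    have h2 : ContinuousOn (fun t : ℝ => (1 + t) ^ a) (Set.uIcc 0 1) := by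
      rw [Set.uIcc_of_le zero_le_one]
      refine ContinuousOn.rpow_const (by fun_prop) fun t ht => Or.inl ?_
      have := ht.1
      positivity
    refine (h1.mul_continuousOn h2).congr fun t ht => ?_
    rw [Set.uIoc_of_le zero_le_one] at ht
    change (1 - t) ^ a * (1 + t) ^ a = (1 - t ^ 2) ^ a
    rw [← Real.mul_rpow (by linarith [ht.2]) (by linarith [ht.1])]
    ring_nf
  have h10 : IntervalIntegrable (fun t : ℝ => (1 - t ^ 2) ^ a) volume (-1) 0 := by
    have := ((IntervalIntegrable.iff_comp_neg (f := fun t : ℝ => (1 - t ^ 2) ^ a)).1 h01).symm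
    simpa using this
  exact h10.trans h01

/-- Integration of polynomials over `[-1,1]` against the ultraspherical weight
`(1-z²)^(l-1/2)`. -/
noncomputable def ultraInt (l : ℝ) (hl : 0 < l) : ℝ[X] →ₗ[ℝ] ℝ where
  toFun p := ∫ z in (-1 : ℝ)..1, p.eval z * (1 - z ^ 2) ^ (l - 1 / 2)
  map_add' p q := by
    simp only [eval_add, add_mul]
    have h := intervalIntegrable_one_sub_sq_rpow (a := l - 1 / 2) (by linarith)
    exact intervalIntegral.integral_add (h.continuousOn_mul (by fun_prop))
      (h.continuousOn_mul (by fun_prop))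
  map_smul' c p := by
    simp [mul_assoc]

theorem ultraInt_apply {l : ℝ} (hl : 0 < l) (p : ℝ[X]) :
    ultraInt l hl p = ∫ z in (-1 : ℝ)..1, p.eval z * (1 - z ^ 2) ^ (l - 1 / 2) := rfl

theorem ultraInt_C_mul {l : ℝ} (hl : 0 < l) (a : ℝ) (p : ℝ[X]) :
    ultraInt l hl (C a * p) = a * ultraInt l hl p := by
  rw [← smul_eq_C_mul, map_smul, smul_eq_mul]

theorem ultraInt_ibp {l : ℝ} (hl : 0 < l) (p : ℝ[X]) :
    ultraInt l hl ((1 - X ^ 2) * derivative p - C (2 * l + 1) * X * p) = 0 := by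
  have hw := intervalIntegrable_one_sub_sq_rpow (a := l - 1 / 2) (by linarith)
  have hd : ∀ z ∈ Set.Ioo (-1 : ℝ) 1, HasDerivAt (fun z => (1 - z ^ 2) ^ (l + 1 / 2) * p.eval z)
      (((1 - X ^ 2) * derivative p - C (2 * l + 1) * X * p).eval z *
        (1 - z ^ 2) ^ (l - 1 / 2)) z := by
    intro z hz
    have hpos : 0 < 1 - z ^ 2 := by nlinarith [hz.1, hz.2]
    have h1 : HasDerivAt (fun z : ℝ => 1 - z ^ 2) (-(2 * z)) z := by
      simpa using (hasDerivAt_pow 2 z).const_sub 1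
    have h2 := (h1.rpow_const (p := l + 1 / 2) (Or.inl hpos.ne')).mul (p.hasDerivAt z)
    refine h2.congr_deriv ?_
    have e1 : l + 1 / 2 - 1 = l - 1 / 2 := by ring
    have e2 : (1 - z ^ 2) ^ (l + 1 / 2) = (1 - z ^ 2) ^ (l - 1 / 2) * (1 - z ^ 2) := by
      rw [← Real.rpow_add_one hpos.ne']; congr 1; ring
    rw [e1, e2]
    simp
    ring
  have hc : ContinuousOn (fun z : ℝ => (1 - z ^ 2) ^ (l + 1 / 2) * p.eval z) (Set.Icc (-1) 1) := by
    refine ContinuousOn.mul (ContinuousOn.rpow_const (by fun_prop) fun _ _ => Or.inr ?_)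
      (by fun_prop)
    linarith
  rw [ultraInt_apply, intervalIntegral.integral_eq_sub_of_hasDerivAt_of_le (by norm_num) hc hd
    (hw.continuousOn_mul (by fun_prop))]
  have : l + 1 / 2 ≠ 0 := by linarith
  norm_num [Real.zero_rpow this]

theorem ultraInt_gegen_mul_X_pow {l : ℝ} (hl : 0 < l) {m k : ℕ} (hk : k < m) :
    ultraInt l hl (gegen l m * X ^ k) = 0 := by
  induction k using Nat.strong_induction_on with
  | _ k ih =>
    have h := ultraInt_ibp hl
      (derivative (gegen l m) * X ^ k - gegen l m * derivative (X ^ k))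
    have hode := gegen_ode l m
    have hX : (1 - X ^ 2 : ℝ[X]) * derivative (derivative (X ^ k)) -
        C (2 * l + 1) * X * derivative (X ^ k) =
        C (k * (k - 1) : ℝ) * X ^ (k - 2) - C (k * (k + 2 * l)) * X ^ k := by
      rcases k with _ | _ | k
      · simp
      · simp; ring
      · simp only [derivative_X_pow, derivative_mul, derivative_C]
        push_cast
        simp only [C_add, C_mul, C_sub, map_natCast, map_ofNat, C_1]
        simp
        ring
    have key : (1 - X ^ 2 : ℝ[X]) * derivative (derivative (gegen l m) * X ^ k -
        gegen l m * derivative (X ^ k)) - C (2 * l + 1) * X * (derivative (gegen l m) * X ^ k -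
        gegen l m * derivative (X ^ k)) =
        C (k * (k + 2 * l) - m * (m + 2 * l)) * (gegen l m * X ^ k) -
          C (k * (k - 1) : ℝ) * (gegen l m * X ^ (k - 2)) := by
      rw [derivative_sub, derivative_mul, derivative_mul, C_sub]
      linear_combination X ^ k * hode - gegen l m * hX
    rw [key, map_sub, ultraInt_C_mul, ultraInt_C_mul] at h
    have h0 : (k * (k - 1) : ℝ) * ultraInt l hl (gegen l m * X ^ (k - 2)) = 0 := by
      rcases k with _ | _ | k
      · simp
      · simp
      · rw [ih (k + 1 + 1 - 2) (by omega) (by omega), mul_zero]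
    rw [h0, sub_zero] at h
    refine (mul_eq_zero.1 h).resolve_left ?_
    have hkm : (k : ℝ) < m := by exact_mod_cast hk
    have : (0 : ℝ) ≤ k := by positivity
    nlinarith

theorem ultraInt_gegen_mul_of_natDegree_lt {l : ℝ} (hl : 0 < l) {m : ℕ} {p : ℝ[X]}
    (hp : p.natDegree < m) : ultraInt l hl (gegen l m * p) = 0 := by
  rw [p.as_sum_range_C_mul_X_pow, Finset.mul_sum, map_sum]
  refine Finset.sum_eq_zero fun k hk => ?_
  rw [mul_left_comm, ultraInt_C_mul,
    ultraInt_gegen_mul_X_pow hl (by have := Finset.mem_range.1 hk; omega), mul_zero]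

theorem ultraInt_gegen_sq {l : ℝ} (hl : 0 < l) (m : ℕ) :
    (m + l) * ultraInt l hl (gegen l m * gegen l m) =
      l * ultraInt l hl 1 * (gegen l m).eval 1 := by
  induction m with
  | zero => simp [gegen]
  | succ m ih =>
    have h1 : ((m : ℝ) + 1) * ultraInt l hl (gegen l (m + 1) * gegen l (m + 1)) =
        2 * (m + l) * ultraInt l hl (X * (gegen l m * gegen l (m + 1))) := by
      cases m with
      | zero =>
        rw [← ultraInt_C_mul, ← ultraInt_C_mul]
        simp [gegen, mul_comm, mul_left_comm]
      | succ k =>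
        have h := congrArg (fun p => ultraInt l hl (gegen l (k + 2) * p)) (gegen_rec l k)
        have e : gegen l (k + 2) * (C (2 * (k + 1 + l)) * X * gegen l (k + 1) -
            C (k + 2 * l) * gegen l k) = C (2 * (k + 1 + l)) *
            (X * (gegen l (k + 1) * gegen l (k + 2))) -
            C (k + 2 * l) * (gegen l (k + 2) * gegen l k) := by ring
        simp only [e, map_sub] at h
        rw [mul_left_comm, ultraInt_C_mul, ultraInt_C_mul, ultraInt_C_mul,
          ultraInt_gegen_mul_of_natDegree_lt hl
            (lt_of_le_of_lt (gegen_natDegree_le l k) (by omega))] at h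
        push_cast
        linarith
    have h2 : 2 * (m + 1 + l) * ultraInt l hl (X * (gegen l m * gegen l (m + 1))) =
        (m + 2 * l) * ultraInt l hl (gegen l m * gegen l m) := by
      have h := congrArg (fun p => ultraInt l hl (p * gegen l m)) (gegen_rec l m)
      have e : (C (2 * (m + 1 + l)) * X * gegen l (m + 1) - C (m + 2 * l) * gegen l m) *
          gegen l m = C (2 * (m + 1 + l)) * (X * (gegen l m * gegen l (m + 1))) -
            C (m + 2 * l) * (gegen l m * gegen l m) := by ring
      simp only [e, map_sub] at h
      rw [mul_assoc, ultraInt_C_mul, ultraInt_C_mul, ultraInt_C_mul,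
        ultraInt_gegen_mul_of_natDegree_lt hl
          (lt_of_le_of_lt (gegen_natDegree_le l m) (by omega))] at h
      linarith
    have h3 := gegen_eval_one_succ l m
    have hm : (m + 1 : ℝ) ≠ 0 := by positivity
    have hml : (0 : ℝ) ≤ m := by positivity
    apply mul_left_cancel₀ hm
    push_cast
    linear_combination ((m : ℝ) + 1 + l) * h1 + (m + l) * h2 + (m + 2 * l) * ih -
      l * ultraInt l hl 1 * h3

theorem ultraInt_one_pos {l : ℝ} (hl : 0 < l) : 0 < ultraInt l hl 1 := by
  rw [ultraInt_apply]
  simp only [eval_one, one_mul]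
  refine intervalIntegral.intervalIntegral_pos_of_pos_on
    (intervalIntegrable_one_sub_sq_rpow (by linarith)) (fun z hz => ?_) (by norm_num)
  have : 0 < 1 - z ^ 2 := by nlinarith [hz.1, hz.2]
  positivity

end UltrasphericalWeight

section QuadraticTransformation

open Polynomial

theorem integral_wJac_eq_ultraInt {l : ℝ} (hl : 0 < l) (g : ℝ[X]) :
    ∫ s in (-1 : ℝ)..1, g.eval s * wJac (l - 1 / 2) (-(1 / 2)) s =
      2 ^ l * ultraInt l hl (g.comp (C 2 * X ^ 2 - 1)) := by
  set h : ℝ → ℝ := fun z => (g.comp (C 2 * X ^ 2 - 1)).eval z * (1 - z ^ 2) ^ (l - 1 / 2) with hh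
  have hint : IntervalIntegrable h volume (-1) 1 :=
    (intervalIntegrable_one_sub_sq_rpow (by linarith)).continuousOn_mul (by fun_prop)
  have hsub : Set.uIcc (0 : ℝ) 1 ⊆ Set.uIcc (-1) 1 := by
    rw [Set.uIcc_of_le (by norm_num), Set.uIcc_of_le (by norm_num)]
    exact Set.Icc_subset_Icc (by norm_num) le_rfl
  have hsub' : Set.uIcc (-1 : ℝ) 0 ⊆ Set.uIcc (-1) 1 := by
    rw [Set.uIcc_of_le (by norm_num), Set.uIcc_of_le (by norm_num)]
    exact Set.Icc_subset_Icc le_rfl (by norm_num)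
  have heven : ∫ z in (-1 : ℝ)..1, h z = 2 * ∫ z in (0 : ℝ)..1, h z := by
    rw [← intervalIntegral.integral_add_adjacent_intervals (hint.mono_set hsub')
      (hint.mono_set hsub)]
    have : ∫ z in (-1 : ℝ)..0, h z = ∫ z in (0 : ℝ)..1, h z := by
      have e := intervalIntegral.integral_comp_neg (a := 0) (b := 1) h
      rw [neg_zero] at e
      rw [← e]
      simp [hh]
    rw [this, two_mul]
  have himg : (fun z : ℝ => 2 * z ^ 2 - 1) '' Set.Ioo 0 1 = Set.Ioo (-1) 1 := by
    ext s
    simp only [Set.mem_image, Set.mem_Ioo]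
    constructor
    · rintro ⟨z, ⟨h0, h1⟩, rfl⟩
      constructor <;> nlinarith
    · rintro ⟨h0, h1⟩
      refine ⟨√((s + 1) / 2), ⟨Real.sqrt_pos.2 (by linarith), ?_⟩, ?_⟩
      · rw [Real.sqrt_lt' one_pos]; linarith
      · rw [Real.sq_sqrt (by linarith)]; ring
  have hinj : Set.InjOn (fun z : ℝ => 2 * z ^ 2 - 1) (Set.Ioo 0 1) := by
    intro a ha b hb hab
    have : a ^ 2 = b ^ 2 := by simpa using hab
    exact (sq_eq_sq₀ ha.1.le hb.1.le).1 this
  have hder : ∀ z ∈ Set.Ioo (0 : ℝ) 1,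
      HasDerivWithinAt (fun z : ℝ => 2 * z ^ 2 - 1) (4 * z) (Set.Ioo 0 1) z := by
    intro z _
    have := (((hasDerivAt_pow 2 z).const_mul 2).sub_const 1)
    refine (this.congr_deriv ?_).hasDerivWithinAt
    simp; ring
  rw [intervalIntegral.integral_of_le (by norm_num), integral_Ioc_eq_integral_Ioo, ← himg,
    integral_image_eq_integral_abs_deriv_smul measurableSet_Ioo hder hinj, ultraInt_apply]
  change _ = 2 ^ l * ∫ z in (-1 : ℝ)..1, h z
  rw [heven, intervalIntegral.integral_of_le (by norm_num), integral_Ioc_eq_integral_Ioo,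
    ← mul_assoc, ← MeasureTheory.integral_const_mul]
  refine setIntegral_congr_fun measurableSet_Ioo fun z hz => ?_
  have hz0 : 0 < z := hz.1
  have hz1 : 0 < 1 - z ^ 2 := by nlinarith [hz.2]
  have e1 : (1 - (2 * z ^ 2 - 1)) ^ (l - 1 / 2) = 2 ^ (l - 1 / 2) * (1 - z ^ 2) ^ (l - 1 / 2) := by
    rw [← Real.mul_rpow (by norm_num) hz1.le]; ring_nf
  have e2 : (1 + (2 * z ^ 2 - 1)) ^ (-(1 / 2) : ℝ) = 2 ^ (-(1 / 2) : ℝ) * z⁻¹ := by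
    rw [show 1 + (2 * z ^ 2 - 1) = 2 * z ^ 2 by ring, Real.mul_rpow (by norm_num) (by positivity),
      ← Real.rpow_natCast z 2, ← Real.rpow_mul hz0.le]
    norm_num [Real.rpow_neg_one]
  have e3 : (2 : ℝ) ^ l = 2 * (2 ^ (l - 1 / 2) * 2 ^ (-(1 / 2) : ℝ)) := by
    rw [← Real.rpow_add two_pos, ← Real.rpow_one_add' (by norm_num) (by linarith)]
    ring_nf
  simp only [hh, wJac, smul_eq_mul, eval_comp]
  rw [e1, e2, e3, abs_of_pos (by positivity)]
  simp
  field_simp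
  norm_num

theorem ultraInt_eq_zero_of_odd {l : ℝ} (hl : 0 < l) {p : ℝ[X]} (hp : p.comp (-X) = -p) :
    ultraInt l hl p = 0 := by
  have e := intervalIntegral.integral_comp_neg (a := -1) (b := 1)
    (fun z : ℝ => p.eval z * (1 - z ^ 2) ^ (l - 1 / 2))
  have hz : ∀ z, p.eval (-z) = -p.eval z := fun z => by
    have := congrArg (eval z) hp
    simpa using this
  simp only [hz, neg_mul, intervalIntegral.integral_neg, even_two, Even.neg_pow, neg_neg] at e
  rw [ultraInt_apply]
  linarith

theorem eq_zero_of_ultraInt_sq {l : ℝ} (hl : 0 < l) {p : ℝ[X]} (hp : ultraInt l hl (p * p) = 0) :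
    p = 0 := by
  by_contra hp0
  have hint : IntervalIntegrable (fun z : ℝ => (p * p).eval z * (1 - z ^ 2) ^ (l - 1 / 2))
      volume (-1) 1 :=
    (intervalIntegrable_one_sub_sq_rpow (by linarith)).continuousOn_mul (by fun_prop)
  rw [intervalIntegrable_iff_integrableOn_Ioo_of_le (by norm_num)] at hint
  rw [ultraInt_apply, intervalIntegral.integral_of_le (by norm_num),
    integral_Ioc_eq_integral_Ioo] at hp
  have hnn : ∀ z ∈ Set.Ioo (-1 : ℝ) 1, 0 < 1 - z ^ 2 := fun z hz => by nlinarith [hz.1, hz.2]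
  have hae := (setIntegral_eq_zero_iff_of_nonneg_ae (by
    filter_upwards [ae_restrict_mem measurableSet_Ioo] with z hz
    have := hnn z hz
    simp only [Pi.zero_apply, eval_mul]
    exact mul_nonneg (mul_self_nonneg _) (by positivity)) hint).1 hp
  have hroots : ∀ᵐ z ∂(volume.restrict (Set.Ioo (-1 : ℝ) 1)), z ∈ p.roots.toFinset := by
    filter_upwards [hae, ae_restrict_mem measurableSet_Ioo] with z hz hzm
    have := Real.rpow_pos_of_pos (hnn z hzm) (l - 1 / 2)
    simp only [Pi.zero_apply, eval_mul, mul_eq_zero, this.ne', or_false, or_self] at hz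
    simpa [hp0] using hz
  rw [ae_restrict_iff' measurableSet_Ioo] at hroots
  have h0 : volume (Set.Ioo (-1 : ℝ) 1) = 0 := by
    have hfin : volume (p.roots.toFinset : Set ℝ) = 0 := Finset.measure_zero _ _
    have hn : ∀ᵐ z : ℝ, z ∉ (p.roots.toFinset : Set ℝ) := measure_eq_zero_iff_ae_notMem.1 hfin
    refine measure_eq_zero_iff_ae_notMem.2 ?_
    filter_upwards [hroots, hn] with z h1 h2 h3
    exact h2 (h1 h3)
  norm_num at h0

theorem jacobi_eval_eq_gegen {l : ℝ} (hl : 0 < l) (q : ℕ → ℝ[X]) (hqdeg : ∀ k, (q k).degree = k)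
    (hqorth : ∀ j k, (∫ t in (-1 : ℝ)..1,
      (q j).eval t * (q k).eval t * wJac (l - 1 / 2) (-(1 / 2)) t) = if j = k then 1 else 0)
    (n : ℕ) (z : ℝ) :
    (q n).eval 1 * (q n).eval (2 * z ^ 2 - 1) =
      (2 ^ l * (l * ultraInt l hl 1))⁻¹ * ((2 * n + l) * (gegen l (2 * n)).eval z) := by
  set U : ℝ[X] := C 2 * X ^ 2 - 1 with hU
  have h2l : (0 : ℝ) < 2 ^ l := by positivity
  have hort : ∀ j k, 2 ^ l * ultraInt l hl ((q j * q k).comp U) = if j = k then 1 else 0 := by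
    intro j k
    rw [← integral_wJac_eq_ultraInt hl, ← hqorth j k]
    simp
  have hlow : ∀ N ≤ n, ∀ v : ℝ[X], v.degree < N → ultraInt l hl ((q n * v).comp U) = 0 := by
    intro N
    induction N with
    | zero =>
      intro _ v hv
      have : v = 0 := degree_eq_bot.1 (Nat.WithBot.lt_zero_iff.1 hv)
      simp [this]
    | succ N ih =>
      intro hN v hv
      have hq0 : (q N).coeff N ≠ 0 := by
        have := hqdeg N
        exact coeff_ne_zero_of_eq_degree this
      have hd : (v - C (v.coeff N / (q N).coeff N) * q N).degree < N := by
        rw [degree_lt_iff_coeff_zero]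
        intro m hm
        rcases hm.eq_or_lt with rfl | hm
        · simp [hq0]
        · rw [coeff_sub, coeff_C_mul, coeff_eq_zero_of_degree_lt (hv.trans_le ?_),
            coeff_eq_zero_of_degree_lt (p := q N) (n := m), mul_zero, sub_zero]
          · rw [hqdeg]; exact_mod_cast hm
          · exact_mod_cast hm
      have h1 := ih (by omega) _ hd
      have h2 := hort n N
      rw [if_neg (by omega)] at h2
      have h3 := (mul_eq_zero.1 h2).resolve_left h2l.ne'
      have e : (q n * v).comp U = (q n * (v - C (v.coeff N / (q N).coeff N) * q N)).comp U +
          C (v.coeff N / (q N).coeff N) * (q n * q N).comp U := by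
        simp only [mul_comp, sub_comp, C_comp]; ring
      rw [e, map_add, h1, ultraInt_C_mul, h3, mul_zero, add_zero]
  set u : ℝ[X] := (q n).comp U with hu
  have hXpow : ∀ k < 2 * n, ultraInt l hl (u * X ^ k) = 0 := by
    intro k hk
    rcases Nat.even_or_odd' k with ⟨j, rfl | rfl⟩
    · have hv : (((C (1 / 2) * (X + 1)) ^ j : ℝ[X])).comp U = X ^ (2 * j) := by
        rw [pow_comp, pow_mul]
        congr 1
        simp only [mul_comp, add_comp, C_comp, X_comp, one_comp, hU]
        rw [sub_add_cancel, ← mul_assoc, ← C_mul]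
        norm_num
      have hd : ((C (1 / 2) * (X + 1)) ^ j : ℝ[X]).degree < (n : ℕ) := by
        refine lt_of_le_of_lt degree_le_natDegree ?_
        have : ((C (1 / 2) * (X + 1)) ^ j : ℝ[X]).natDegree ≤ j := by
          refine natDegree_pow_le.trans ?_
          have : (C (1 / 2) * (X + 1) : ℝ[X]).natDegree ≤ 1 :=
            (natDegree_C_mul_le _ _).trans (by rw [← C_1, natDegree_X_add_C])
          nlinarith
        exact_mod_cast lt_of_le_of_lt this (by omega)
      have := hlow n le_rfl _ hd
      rwa [mul_comp, hv] at this
    · refine ultraInt_eq_zero_of_odd hl ?_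
      rw [mul_comp, hu, comp_assoc]
      have : U.comp (-X) = U := by simp [hU]
      rw [this, pow_comp, X_comp, Odd.neg_pow ⟨j, rfl⟩, mul_neg]
  have hUdeg : U.natDegree = 2 := by
    rw [hU, ← C_1]; compute_degree!
  have hudeg : u.natDegree = 2 * n := by
    rw [hu, natDegree_comp, hUdeg, natDegree_eq_of_degree_eq_some (hqdeg n), mul_comm]
  have hu0 : u.coeff (2 * n) ≠ 0 := by
    rw [← hudeg, coeff_natDegree, hu, leadingCoeff_comp (by rw [hUdeg]; norm_num)]
    refine mul_ne_zero ?_ (pow_ne_zero _ ?_)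
    · rw [leadingCoeff_ne_zero]
      intro h0
      have := hqdeg n
      rw [h0, degree_zero] at this
      exact absurd this (by simp)
    · rw [leadingCoeff_ne_zero]
      intro h0
      rw [h0] at hUdeg
      simp at hUdeg
  set A : ℝ := (gegen l (2 * n)).coeff (2 * n) / u.coeff (2 * n) with hA
  have hpdeg : (gegen l (2 * n) - C A * u).degree < (2 * n : ℕ) := by
    rw [degree_lt_iff_coeff_zero]
    intro m hm
    rcases hm.eq_or_lt with rfl | hm
    · simp [hA, hu0]
    · rw [coeff_sub, coeff_C_mul, coeff_eq_zero_of_natDegree_lt (by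
        exact lt_of_le_of_lt (gegen_natDegree_le _ _) hm),
        coeff_eq_zero_of_natDegree_lt (by omega), mul_zero, sub_zero]
  have hp : gegen l (2 * n) - C A * u = 0 := by
    refine eq_zero_of_ultraInt_sq hl ?_
    set p := gegen l (2 * n) - C A * u with hp
    have h1 : ∀ f : ℝ[X], (∀ k < 2 * n, ultraInt l hl (f * X ^ k) = 0) →
        ultraInt l hl (f * p) = 0 := by
      intro f hf
      by_cases hp0 : p = 0
      · simp [hp0]
      rw [p.as_sum_range_C_mul_X_pow, Finset.mul_sum, map_sum]
      refine Finset.sum_eq_zero fun k hk => ?_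
      rw [mul_left_comm, ultraInt_C_mul, hf k, mul_zero]
      have := (natDegree_lt_iff_degree_lt hp0).2 hpdeg
      have := Finset.mem_range.1 hk
      omega
    have e : p * p = gegen l (2 * n) * p - C A * (u * p) := by
      nth_rewrite 1 [hp]; ring
    rw [e, map_sub, ultraInt_C_mul, h1 u hXpow,
      h1 _ fun k hk => ultraInt_gegen_mul_X_pow hl hk, mul_zero, sub_zero]
  rw [sub_eq_zero] at hp
  have hsq := ultraInt_gegen_sq hl (2 * n)
  have huu : 2 ^ l * ultraInt l hl (u * u) = 1 := by
    have := hort n n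
    rwa [if_pos rfl, mul_comp] at this
  have hgg : ultraInt l hl (gegen l (2 * n) * gegen l (2 * n)) =
      A * A * ultraInt l hl (u * u) := by
    rw [hp, show C A * u * (C A * u) = C A * (C A * (u * u)) by ring, ultraInt_C_mul,
      ultraInt_C_mul, mul_assoc]
  have hev : ∀ z, (gegen l (2 * n)).eval z = A * (q n).eval (2 * z ^ 2 - 1) := by
    intro z
    rw [hp]
    simp [hu, hU]
  have h1 := hev 1
  norm_num at h1
  have hpos := gegen_eval_one_pos hl (2 * n)
  have hA0 : A ≠ 0 := by
    rintro h0
    rw [h1, h0, zero_mul] at hpos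
    exact hpos.false
  have h0 := ultraInt_one_pos hl
  rw [hgg, h1] at hsq
  push_cast at hsq
  have hkey : (2 * n + l) * A = 2 ^ l * (l * ultraInt l hl 1) * (q n).eval 1 := by
    apply mul_left_cancel₀ hA0
    linear_combination 2 ^ l * hsq - (2 * n + l) * A * A * huu
  rw [hev z, eq_inv_mul_iff_mul_eq₀ (by positivity)]
  linear_combination -(q n).eval (2 * z ^ 2 - 1) * hkey

end QuadraticTransformation

section CauchyCoefficients

open Complex Metric

/-- The quadratic `1 - 2 z r + r²` of the Gegenbauer generating function. -/
noncomputable def genQuad (z : ℝ) (r : ℂ) : ℂ := 1 - 2 * z * r + r ^ 2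

theorem genQuad_mem_slitPlane {z : ℝ} (hz : |z| ≤ 1) {r : ℂ} (hr : ‖r‖ < 1) :
    genQuad z r ∈ slitPlane := by
  have hn : r.re ^ 2 + r.im ^ 2 < 1 := by
    have := Complex.sq_norm r
    rw [Complex.normSq_apply] at this
    nlinarith [norm_nonneg r]
  have hre : (genQuad z r).re = 1 - 2 * z * r.re + (r.re ^ 2 - r.im ^ 2) := by
    simp [genQuad, pow_two]
  have him : (genQuad z r).im = 2 * r.im * (r.re - z) := by
    simp [genQuad, pow_two]; ring
  obtain ⟨hz1, hz2⟩ := abs_le.1 hz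
  rw [mem_slitPlane_iff, hre, him]
  by_cases hb : r.im = 0
  · left
    rw [hb] at hn ⊢
    have h1 : r.re < 1 := by nlinarith
    have h2 : -1 < r.re := by nlinarith
    rcases le_total 0 r.re with h | h <;> nlinarith
  · by_cases ha : r.re = z
    · left; nlinarith
    · right
      exact mul_ne_zero (mul_ne_zero two_ne_zero hb) (sub_ne_zero.2 ha)

theorem hasDerivAt_genQuad (z : ℝ) (r : ℂ) : HasDerivAt (genQuad z) (2 * (r - z)) r := by
  have h := (((hasDerivAt_id r).const_mul (2 * z : ℂ)).const_sub 1).add (hasDerivAt_pow 2 r)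
  refine (h.congr_deriv ?_)
  simp; ring

theorem hasDerivAt_genQuad_cpow {z : ℝ} (hz : |z| ≤ 1) {r : ℂ} (hr : ‖r‖ < 1) (μ : ℝ) :
    HasDerivAt (fun r => genQuad z r ^ (-μ : ℂ))
      (2 * μ * (z - r) * genQuad z r ^ (-((μ + 1 : ℝ) : ℂ))) r := by
  have h := (hasDerivAt_genQuad z r).cpow_const (c := (-μ : ℂ)) (genQuad_mem_slitPlane hz hr)
  refine h.congr_deriv ?_
  rw [show (-((μ + 1 : ℝ) : ℂ)) = -μ - 1 by push_cast; ring]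
  ring

theorem continuousOn_genQuad_cpow_mul_zpow {z : ℝ} (hz : |z| ≤ 1) {R : ℝ} (hR0 : 0 < R)
    (hR : R < 1) (μ : ℝ) (k : ℤ) :
    ContinuousOn (fun r => genQuad z r ^ (-μ : ℂ) * r ^ k) (sphere 0 R) := by
  intro r hr
  have hr' : ‖r‖ = R := by simpa using hr
  have h0 : r ≠ 0 := by rw [← norm_pos_iff, hr']; exact hR0
  exact ((hasDerivAt_genQuad_cpow hz (by rw [hr']; exact hR) μ).continuousAt.mul
    (continuousAt_zpow₀ r k (Or.inl h0))).continuousWithinAt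

/-- The `k`-th Laurent coefficient at `0` of `r ↦ (1 - 2 z r + r²)^(-μ)`, as a Cauchy integral. -/
noncomputable def gegenCoeff (μ z R : ℝ) (k : ℤ) : ℂ :=
  (2 * π * I)⁻¹ * ∮ r in C(0, R), genQuad z r ^ (-μ : ℂ) * r ^ (-k - 1)

theorem circleIntegral_linear {f g h : ℂ → ℂ} {c : ℂ} {R : ℝ} (hf : CircleIntegrable f c R)
    (hg : CircleIntegrable g c R) (hh : CircleIntegrable h c R) (a b e : ℂ) :
    (∮ r in C(c, R), (a * f r - b * g r + e * h r)) =
      a * (∮ r in C(c, R), f r) - b * (∮ r in C(c, R), g r) + e * ∮ r in C(c, R), h r := by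
  have hf' : CircleIntegrable (fun r => a * f r) c R := hf.const_smul
  have hg' : CircleIntegrable (fun r => b * g r) c R := hg.const_smul
  have hh' : CircleIntegrable (fun r => e * h r) c R := hh.const_smul
  have hfg : CircleIntegrable (fun r => a * f r - b * g r) c R := hf'.sub hg'
  rw [circleIntegral.integral_add hfg hh', circleIntegral.integral_sub hf' hg',
    circleIntegral.integral_const_mul, circleIntegral.integral_const_mul,
    circleIntegral.integral_const_mul]

section
variable {z R : ℝ} (hz : |z| ≤ 1) (hR0 : 0 < R) (hR : R < 1)
include hz hR0 hR

theorem circleIntegrable_genQuad (μ : ℝ) (k : ℤ) :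
    CircleIntegrable (fun r => genQuad z r ^ (-μ : ℂ) * r ^ k) 0 R :=
  (continuousOn_genQuad_cpow_mul_zpow hz hR0 hR μ k).circleIntegrable hR0.le

theorem gegenCoeff_neg_one (μ : ℝ) : gegenCoeff μ z R (-1) = 0 := by
  have h := circleIntegral_eq_zero_of_differentiable_on_off_countable (c := 0) hR0.le
    Set.countable_empty (f := fun r => genQuad z r ^ (-μ : ℂ)) (fun r hr =>
      (hasDerivAt_genQuad_cpow hz (lt_of_le_of_lt (by simpa using hr) hR)
        μ).continuousAt.continuousWithinAt) (fun r hr =>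
      (hasDerivAt_genQuad_cpow hz (lt_trans (by simpa using hr.1) hR) μ).differentiableAt)
  simp [gegenCoeff, h]

theorem gegenCoeff_zero (μ : ℝ) : gegenCoeff μ z R 0 = 1 := by
  have h := circleIntegral_sub_inv_smul_of_differentiable_on_off_countable (c := 0) (w := 0)
    (R := R) Set.countable_empty (by simpa using hR0) (f := fun r => genQuad z r ^ (-μ : ℂ))
    (fun r hr =>
      (hasDerivAt_genQuad_cpow hz (lt_of_le_of_lt (by simpa using hr) hR)
        μ).continuousAt.continuousWithinAt) (fun r hr =>
      (hasDerivAt_genQuad_cpow hz (lt_trans (by simpa using hr.1) hR) μ).differentiableAt)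
  have e : (∮ r in C(0, R), genQuad z r ^ (-μ : ℂ) * r ^ (-(0 : ℤ) - 1)) = 2 * π * I := by
    have h0 : genQuad z 0 ^ (-μ : ℂ) = 1 := by simp [genQuad]
    rw [h0, smul_eq_mul, mul_one] at h
    rw [← h]
    refine circleIntegral.integral_congr hR0.le fun r _ => ?_
    simp [mul_comm]
  rw [gegenCoeff, e, inv_mul_cancel₀ (by simp [Real.pi_ne_zero])]

theorem gegenCoeff_deriv (μ : ℝ) (k : ℤ) :
    k * gegenCoeff μ z R k =
      2 * μ * (z * gegenCoeff (μ + 1) z R (k - 1) - gegenCoeff (μ + 1) z R (k - 2)) := by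
  have hd : ∀ r ∈ sphere (0 : ℂ) R, HasDerivWithinAt (fun r => genQuad z r ^ (-μ : ℂ) * r ^ (-k))
      (2 * μ * z * (genQuad z r ^ (-((μ + 1 : ℝ) : ℂ)) * r ^ (-(k - 1) - 1)) -
        2 * μ * (genQuad z r ^ (-((μ + 1 : ℝ) : ℂ)) * r ^ (-(k - 2) - 1)) +
        (-k : ℂ) * (genQuad z r ^ (-μ : ℂ) * r ^ (-k - 1))) (sphere 0 R) r := by
    intro r hr
    have hr' : ‖r‖ = R := by simpa using hr
    have h0 : r ≠ 0 := by rw [← norm_pos_iff, hr']; exact hR0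
    have h := (hasDerivAt_genQuad_cpow hz (by rw [hr']; exact hR) μ).mul
      (hasDerivAt_zpow (-k) r (Or.inl h0))
    refine (h.congr_deriv ?_).hasDerivWithinAt
    rw [show -(k - 1) - 1 = -k by ring, show -(k - 2) - 1 = -k + 1 by ring, zpow_add_one₀ h0]
    push_cast
    ring
  have h := circleIntegral.integral_eq_zero_of_hasDerivWithinAt hR0.le hd
  have i1 := fun k => circleIntegrable_genQuad hz hR0 hR μ k
  have i2 := fun k => circleIntegrable_genQuad hz hR0 hR (μ + 1) k
  rw [circleIntegral_linear (i2 _) (i2 _) (i1 _)] at h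
  simp only [gegenCoeff]
  linear_combination -(2 * π * I)⁻¹ * h

theorem gegenCoeff_eq_sub (μ : ℝ) (k : ℤ) :
    gegenCoeff μ z R k = gegenCoeff (μ + 1) z R k - 2 * z * gegenCoeff (μ + 1) z R (k - 1) +
      gegenCoeff (μ + 1) z R (k - 2) := by
  have i2 := fun k => circleIntegrable_genQuad hz hR0 hR (μ + 1) k
  have e : (∮ r in C(0, R), genQuad z r ^ (-μ : ℂ) * r ^ (-k - 1)) =
      ∮ r in C(0, R), (1 * (genQuad z r ^ (-((μ + 1 : ℝ) : ℂ)) * r ^ (-k - 1)) -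
        2 * z * (genQuad z r ^ (-((μ + 1 : ℝ) : ℂ)) * r ^ (-(k - 1) - 1)) +
        1 * (genQuad z r ^ (-((μ + 1 : ℝ) : ℂ)) * r ^ (-(k - 2) - 1))) := by
    refine circleIntegral.integral_congr hR0.le fun r hr => ?_
    have hr' : ‖r‖ = R := by simpa using hr
    have h0 : r ≠ 0 := by rw [← norm_pos_iff, hr']; exact hR0
    have hQ : genQuad z r ≠ 0 :=
      slitPlane_ne_zero (genQuad_mem_slitPlane hz (by rw [hr']; exact hR))
    change genQuad z r ^ (-μ : ℂ) * r ^ (-k - 1) = _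
    rw [show (-μ : ℂ) = -((μ + 1 : ℝ) : ℂ) + 1 by push_cast; ring, cpow_add _ _ hQ, cpow_one,
      show -(k - 1) - 1 = -k - 1 + 1 by ring, show -(k - 2) - 1 = -k - 1 + 1 + 1 by ring,
      zpow_add_one₀ h0 (-k - 1 + 1), zpow_add_one₀ h0 (-k - 1)]
    nth_rewrite 2 [genQuad]
    ring
  rw [circleIntegral_linear (i2 _) (i2 _) (i2 _)] at e
  simp only [gegenCoeff, e]
  ring

theorem gegenCoeff_mul (μ : ℝ) (k : ℤ) : (k + μ) * gegenCoeff μ z R k =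
    μ * (gegenCoeff (μ + 1) z R k - gegenCoeff (μ + 1) z R (k - 2)) := by
  linear_combination gegenCoeff_deriv hz hR0 hR μ k + μ * gegenCoeff_eq_sub hz hR0 hR μ k

theorem gegenCoeff_rec (μ : ℝ) (k : ℤ) : k * gegenCoeff μ z R k =
    (2 * k - 2 + 2 * μ) * z * gegenCoeff μ z R (k - 1) -
      (k - 2 + 2 * μ) * gegenCoeff μ z R (k - 2) := by
  have h1 := gegenCoeff_mul hz hR0 hR μ (k - 1)
  have h2 := gegenCoeff_mul hz hR0 hR μ (k - 2)
  have h3 := gegenCoeff_eq_sub hz hR0 hR μ (k - 2)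
  have h4 := gegenCoeff_deriv hz hR0 hR μ k
  rw [show k - 1 - 2 = k - 3 by ring] at h1
  rw [show k - 2 - 2 = k - 4 by ring] at h2
  rw [show k - 2 - 1 = k - 3 by ring, show k - 2 - 2 = k - 4 by ring] at h3
  push_cast at h1 h2
  linear_combination h4 - 2 * z * h1 + h2 + μ * h3

theorem gegenCoeff_natCast (μ : ℝ) (m : ℕ) :
    gegenCoeff μ z R m = ((gegen μ m).eval z : ℝ) := by
  induction m using Nat.twoStepInduction with
  | zero => simp [gegen, gegenCoeff_zero hz hR0 hR]
  | one =>
    have h := gegenCoeff_rec hz hR0 hR μ 1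
    norm_num [gegenCoeff_zero hz hR0 hR, gegenCoeff_neg_one hz hR0 hR] at h
    simp [gegen, h]
  | more m h0 h1 =>
    have h := gegenCoeff_rec hz hR0 hR μ ((m + 2 : ℕ) : ℤ)
    have hr := congrArg (Polynomial.eval z) (gegen_rec μ m)
    simp only [Polynomial.eval_mul, Polynomial.eval_sub, Polynomial.eval_C,
      Polynomial.eval_X] at hr
    have hr' := congrArg ((↑) : ℝ → ℂ) hr
    push_cast at hr' h h0 h1
    rw [show (m : ℤ) + 2 - 1 = m + 1 by ring, show (m : ℤ) + 2 - 2 = m by ring, h0, h1] at h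
    have hm : (m + 2 : ℂ) ≠ 0 := by exact_mod_cast (Nat.succ_ne_zero (m + 1))
    apply mul_left_cancel₀ hm
    push_cast
    linear_combination h - hr'

/-- The Cauchy integral kernel which extracts the zonal projection kernel of degree `N`
from the generating function with parameter `μ + 2`. -/
noncomputable def projKer (μ : ℝ) (N : ℕ) (r : ℂ) : ℂ :=
  (μ * (μ + 1) / (N + μ + 1) * (1 - r ^ 2) ^ 2 -
    2 * μ * (μ + 1) / ((N + μ + 1) * (N + μ - 1)) * (r ^ 2 * (1 - r ^ 2))) * r ^ (-(N : ℤ) - 1)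

theorem gegen_eq_circleIntegral {μ : ℝ} (hμ : 0 < μ) {N : ℕ} (hN : 1 ≤ N) :
    (((N + μ) * (gegen μ N).eval z : ℝ) : ℂ) =
      (2 * π * I)⁻¹ * ∮ r in C(0, R), genQuad z r ^ (-((μ + 2 : ℝ) : ℂ)) * projKer μ N r := by
  have h0 := gegenCoeff_mul hz hR0 hR μ N
  have h1 := gegenCoeff_mul hz hR0 hR (μ + 1) N
  have h2 := gegenCoeff_mul hz hR0 hR (μ + 1) (N - 2)
  rw [gegenCoeff_natCast hz hR0 hR] at h0
  rw [show μ + 1 + 1 = μ + 2 by ring] at h1 h2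
  rw [show (N : ℤ) - 2 - 2 = N - 4 by ring] at h2
  have hNR : (1 : ℝ) ≤ N := by exact_mod_cast hN
  have n1 : (N + μ + 1 : ℂ) ≠ 0 := by
    have : (N + μ + 1 : ℝ) ≠ 0 := by positivity
    exact_mod_cast this
  have n2 : (N + μ - 1 : ℂ) ≠ 0 := by
    have : (N + μ - 1 : ℝ) ≠ 0 := by linarith
    exact_mod_cast this
  set a : ℂ := μ * (μ + 1) / (N + μ + 1) with ha
  set b : ℂ := 2 * μ * (μ + 1) / ((N + μ + 1) * (N + μ - 1)) with hb
  have i2 := fun k => circleIntegrable_genQuad hz hR0 hR (μ + 2) k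
  have e : (∮ r in C(0, R), genQuad z r ^ (-((μ + 2 : ℝ) : ℂ)) * projKer μ N r) =
      ∮ r in C(0, R), (a * (genQuad z r ^ (-((μ + 2 : ℝ) : ℂ)) * r ^ (-(N : ℤ) - 1)) -
        (2 * a + b) * (genQuad z r ^ (-((μ + 2 : ℝ) : ℂ)) * r ^ (-(N - 2 : ℤ) - 1)) +
        (a + b) * (genQuad z r ^ (-((μ + 2 : ℝ) : ℂ)) * r ^ (-(N - 4 : ℤ) - 1))) := by
    refine circleIntegral.integral_congr hR0.le fun r hr => ?_
    have hr' : ‖r‖ = R := by simpa using hr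
    have hr0 : r ≠ 0 := by rw [← norm_pos_iff, hr']; exact hR0
    simp only [projKer]
    rw [← ha, ← hb, show -((N : ℤ) - 2) - 1 = -(N : ℤ) - 1 + (2 : ℕ) by push_cast; ring,
      show -((N : ℤ) - 4) - 1 = -(N : ℤ) - 1 + (4 : ℕ) by push_cast; ring, zpow_add₀ hr0,
      zpow_add₀ hr0, zpow_natCast, zpow_natCast]
    ring
  rw [circleIntegral_linear (i2 _) (i2 _) (i2 _)] at e
  have hfin : (((N + μ) * (gegen μ N).eval z : ℝ) : ℂ) =
      a * gegenCoeff (μ + 2) z R N - (2 * a + b) * gegenCoeff (μ + 2) z R (N - 2) +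
        (a + b) * gegenCoeff (μ + 2) z R (N - 4) := by
    push_cast at h0 h1 h2 ⊢
    have ha' : a * (N + μ + 1) = μ * (μ + 1) := by rw [ha]; field_simp
    have hab : (a + b) * (N + μ - 1) = μ * (μ + 1) := by
      rw [ha, hb]; field_simp; ring
    rw [h0]
    have c1 : gegenCoeff (μ + 1) z R N = (μ + 1) / (N + μ + 1) *
        (gegenCoeff (μ + 2) z R N - gegenCoeff (μ + 2) z R (N - 2)) := by
      field_simp; linear_combination h1
    have c2 : gegenCoeff (μ + 1) z R (N - 2) = (μ + 1) / (N + μ - 1) *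
        (gegenCoeff (μ + 2) z R (N - 2) - gegenCoeff (μ + 2) z R (N - 4)) := by
      field_simp; linear_combination h2
    have hb' : a + b = μ * (μ + 1) / (N + μ - 1) := by
      rw [eq_div_iff n2]; exact hab
    rw [c1, c2]
    linear_combination (-gegenCoeff (μ + 2) z R (N - 4) + gegenCoeff (μ + 2) z R (N - 2)) * hb'
  rw [hfin, e]
  simp only [gegenCoeff]
  ring

end

end CauchyCoefficients

section ContourShift

open Complex

/-- The path `t ↦ t - ih(1 - t²)` from `-1` to `1` through the lower half plane. -/
noncomputable def lowArc (h t : ℝ) : ℂ := t - I * h * (1 - t ^ 2)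

/-- The quotient of `(1 - s²)^(κ-1) ds` along `s = lowArc h t` by `(1 - t²)^(κ-1) dt`. -/
noncomputable def lowArcWeight (κ h t : ℝ) : ℂ :=
  (1 + I * h * (1 + t)) ^ ((κ - 1 : ℝ) : ℂ) * (1 - I * h * (1 - t)) ^ ((κ - 1 : ℝ) : ℂ) *
    (1 + 2 * I * h * t)

theorem one_add_I_mul_mem_slitPlane (h t : ℝ) : 1 + I * h * (1 + t) ∈ slitPlane := by
  left; simp

theorem one_sub_I_mul_mem_slitPlane (h t : ℝ) : 1 - I * h * (1 - t) ∈ slitPlane := by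
  left; simp

theorem lowArc_im (h t : ℝ) : (lowArc h t).im = -(h * (1 - t ^ 2)) := by
  simp [lowArc, pow_two]

theorem mem_slitPlane_sub_lowArc {W : ℂ} (hW : 0 < W.im) {a : ℝ} (ha : 0 ≤ a) {h t : ℝ}
    (hh : 0 ≤ h) (ht : t ∈ Set.Icc (-1 : ℝ) 1) : W - a * lowArc h t ∈ slitPlane := by
  right
  have h1 : 0 ≤ 1 - t ^ 2 := by nlinarith [ht.1, ht.2]
  have : 0 ≤ a * (h * (1 - t ^ 2)) := by positivity
  rw [sub_im, im_ofReal_mul, lowArc_im]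
  nlinarith

theorem HasDerivAt.cpow_const_log {X : ℝ → ℂ} {X' : ℂ} {s : ℝ} (hX : HasDerivAt X X' s)
    (hs : X s ∈ slitPlane) (c : ℂ) :
    HasDerivAt (fun s => X s ^ c) (X s ^ c * (c * X' / X s)) s := by
  have h := ((hasDerivAt_id (X s)).cpow_const (c := c) hs).comp s hX
  refine h.congr_deriv ?_
  simp only [id]
  rw [cpow_sub _ _ (slitPlane_ne_zero hs), cpow_one]
  ring

/-- The derivative in `h` of `(W - a s)^(-μ)` times the weight at `s = lowArc h t`. -/
noncomputable def lowArcDeriv (μ a κ : ℝ) (W : ℂ) (h t : ℝ) : ℂ :=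
  (W - a * lowArc h t) ^ (-μ : ℂ) *
    ((1 + I * h * (1 + t)) ^ ((κ - 1 : ℝ) : ℂ) * (1 - I * h * (1 - t)) ^ ((κ - 1 : ℝ) : ℂ)) *
    ((1 + 2 * I * h * t) * (-(μ * a * I * (1 - t ^ 2) / (W - a * lowArc h t)) +
      (κ - 1 : ℝ) * I * (1 + t) / (1 + I * h * (1 + t)) -
      (κ - 1 : ℝ) * I * (1 - t) / (1 - I * h * (1 - t))) + 2 * I * t)

section
variable {W : ℂ} (hW : 0 < W.im) {a : ℝ} (ha : 0 ≤ a) {h t : ℝ} (hh : 0 ≤ h)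
include hW ha hh

theorem hasDerivAt_lowArc_height (μ κ : ℝ) (ht : t ∈ Set.Icc (-1 : ℝ) 1) :
    HasDerivAt (fun h => (W - a * lowArc h t) ^ (-μ : ℂ) * lowArcWeight κ h t)
      (lowArcDeriv μ a κ W h t) h := by
  have hid : HasDerivAt (fun h : ℝ => (h : ℂ)) 1 h := (hasDerivAt_id h).ofReal_comp
  have hA : HasDerivAt (fun h : ℝ => 1 + I * h * (1 + t)) (I * (1 + t)) h :=
    (((hid.const_mul I).mul_const (1 + t : ℂ)).const_add 1).congr_deriv (by ring)
  have hB : HasDerivAt (fun h : ℝ => 1 - I * h * (1 - t)) (-(I * (1 - t))) h :=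
    (((hid.const_mul I).mul_const (1 - t : ℂ)).const_sub 1).congr_deriv (by ring)
  have hE : HasDerivAt (fun h : ℝ => 1 + 2 * I * h * t) (2 * I * t) h :=
    (((hid.const_mul (2 * I)).mul_const (t : ℂ)).const_add 1).congr_deriv (by ring)
  have hX : HasDerivAt (fun h : ℝ => W - a * lowArc h t) (a * (I * (1 - t ^ 2))) h :=
    ((((hid.const_mul I).mul_const (1 - t ^ 2 : ℂ)).const_sub (t : ℂ)).const_mul
      (a : ℂ)).const_sub W |>.congr_deriv (by ring)
  have := (hX.cpow_const_log (mem_slitPlane_sub_lowArc hW ha hh ht) (-μ)).mul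
    (((hA.cpow_const_log (one_add_I_mul_mem_slitPlane h t) (κ - 1 : ℝ)).mul
    (hB.cpow_const_log (one_sub_I_mul_mem_slitPlane h t) (κ - 1 : ℝ))).mul hE)
  refine this.congr_deriv ?_
  simp only [lowArcDeriv, Pi.mul_apply]
  ring

theorem hasDerivAt_lowArc_param (μ κ : ℝ) (ht : t ∈ Set.Ioo (-1 : ℝ) 1) :
    HasDerivAt (fun t => -I * ((W - a * lowArc h t) ^ (-μ : ℂ) *
      ((1 + I * h * (1 + t)) ^ ((κ - 1 : ℝ) : ℂ) * (1 - I * h * (1 - t)) ^ ((κ - 1 : ℝ) : ℂ)) *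
      ((1 - t ^ 2) ^ κ : ℝ)))
      (lowArcDeriv μ a κ W h t * ((1 - t ^ 2) ^ (κ - 1) : ℝ)) t := by
  have hpos : 0 < 1 - t ^ 2 := by nlinarith [ht.1, ht.2]
  have hid : HasDerivAt (fun t : ℝ => (t : ℂ)) 1 t := (hasDerivAt_id t).ofReal_comp
  have hA : HasDerivAt (fun t : ℝ => 1 + I * h * (1 + t)) (I * h) t :=
    (((hid.const_add 1).const_mul (I * h)).const_add 1).congr_deriv (by ring)
  have hB : HasDerivAt (fun t : ℝ => 1 - I * h * (1 - t)) (I * h) t :=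
    (((hid.const_sub 1).const_mul (I * h)).const_sub 1).congr_deriv (by ring)
  have hX : HasDerivAt (fun t : ℝ => W - a * lowArc h t) (-(a * (1 + 2 * I * h * t))) t :=
    ((((hid.sub (((hid.pow 2).const_sub 1).const_mul (I * h))).const_mul
      (a : ℂ)).const_sub W).congr_deriv (by
        simp only [Nat.reduceSub, pow_one, Nat.cast_ofNat]; ring))
  have hp : HasDerivAt (fun t : ℝ => (((1 - t ^ 2) ^ κ : ℝ) : ℂ))
      ((-(2 * κ * t) * (1 - t ^ 2) ^ (κ - 1) : ℝ)) t := by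
    have := (((hasDerivAt_pow 2 t).const_sub 1).rpow_const (p := κ) (Or.inl hpos.ne'))
    exact (this.congr_deriv (by
      simp only [Nat.reduceSub, pow_one, Nat.cast_ofNat]; ring)).ofReal_comp
  have hm := mem_slitPlane_sub_lowArc hW ha hh (Set.Ioo_subset_Icc_self ht)
  have := (((hX.cpow_const_log hm (-μ)).mul
    ((hA.cpow_const_log (one_add_I_mul_mem_slitPlane h t) (κ - 1 : ℝ)).mul
    (hB.cpow_const_log (one_sub_I_mul_mem_slitPlane h t) (κ - 1 : ℝ)))).mul hp).const_mul (-I)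
  refine this.congr_deriv ?_
  have e : (((1 - t ^ 2) ^ κ : ℝ) : ℂ) = ((1 - t ^ 2) ^ (κ - 1) : ℝ) * (1 - t ^ 2) := by
    rw [show (1 - t ^ 2 : ℂ) = ((1 - t ^ 2 : ℝ) : ℂ) by push_cast; rfl, ← ofReal_mul,
      ← Real.rpow_add_one hpos.ne']
    simp
  simp only [lowArcDeriv, Pi.mul_apply]
  rw [e]
  have hA0 := slitPlane_ne_zero (one_add_I_mul_mem_slitPlane h t)
  have hB0 := slitPlane_ne_zero (one_sub_I_mul_mem_slitPlane h t)
  have hX0 := slitPlane_ne_zero hm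
  push_cast
  set X := W - a * lowArc h t
  generalize X ^ (-μ : ℂ) = x
  generalize (1 + I * h * (1 + t)) ^ (κ - 1 : ℂ) = y1
  generalize (1 - I * h * (1 - t)) ^ (κ - 1 : ℂ) = y2
  generalize (((1 - t ^ 2) ^ (κ - 1) : ℝ) : ℂ) = v
  field_simp
  ring

end

theorem integrable_one_sub_sq_rpow {κ : ℝ} (hκ : 0 < κ) :
    Integrable (fun t : ℝ => (1 - t ^ 2) ^ (κ - 1)) (volume.restrict (Set.Icc (-1) 1)) := by
  have := intervalIntegrable_one_sub_sq_rpow (a := κ - 1) (by linarith)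
  rwa [intervalIntegrable_iff_integrableOn_Icc_of_le (by norm_num)] at this

theorem continuous_lowArc : Continuous fun p : ℝ × ℝ => lowArc p.1 p.2 := by
  unfold lowArc; fun_prop

theorem continuous_lowArcWeight (κ : ℝ) :
    Continuous fun p : ℝ × ℝ => lowArcWeight κ p.1 p.2 := by
  unfold lowArcWeight
  refine ((Continuous.cpow (by fun_prop) continuous_const fun p => ?_).mul
    (Continuous.cpow (by fun_prop) continuous_const fun p => ?_)).mul (by fun_prop)
  · exact one_add_I_mul_mem_slitPlane _ _
  · exact one_sub_I_mul_mem_slitPlane _ _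

theorem continuousOn_lowArcDeriv (μ κ : ℝ) {a : ℝ} (ha : 0 ≤ a) {W : ℂ} (hW : 0 < W.im) :
    ContinuousOn (fun p : ℝ × ℝ => lowArcDeriv μ a κ W p.1 p.2)
      (Set.Icc 0 1 ×ˢ Set.Icc (-1) 1) := by
  have hX : Continuous fun p : ℝ × ℝ => W - a * lowArc p.1 p.2 :=
    continuous_const.sub (continuous_const.mul continuous_lowArc)
  have hm : ∀ p ∈ Set.Icc (0 : ℝ) 1 ×ˢ Set.Icc (-1 : ℝ) 1, W - a * lowArc p.1 p.2 ∈ slitPlane :=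
    fun p hp => mem_slitPlane_sub_lowArc hW ha hp.1.1 hp.2
  unfold lowArcDeriv
  refine ((hX.continuousOn.cpow_const hm).mul (Continuous.continuousOn
    ((Continuous.cpow (by fun_prop) continuous_const fun p => one_add_I_mul_mem_slitPlane _ _).mul
    (Continuous.cpow (by fun_prop) continuous_const fun p => one_sub_I_mul_mem_slitPlane _ _)))).mul
    (ContinuousOn.add (ContinuousOn.mul (by fun_prop) (ContinuousOn.sub
    (ContinuousOn.add (ContinuousOn.neg (ContinuousOn.div (by fun_prop) hX.continuousOn
    fun p hp => slitPlane_ne_zero (hm p hp))) (ContinuousOn.div (by fun_prop) (by fun_prop)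
    fun p _ => slitPlane_ne_zero (one_add_I_mul_mem_slitPlane _ _)))
    (ContinuousOn.div (by fun_prop) (by fun_prop)
    fun p _ => slitPlane_ne_zero (one_sub_I_mul_mem_slitPlane _ _)))) (by fun_prop))

theorem integral_lowArcDeriv {κ : ℝ} (hκ : 0 < κ) (μ : ℝ) {a : ℝ} (ha : 0 ≤ a) {W : ℂ}
    (hW : 0 < W.im) {h : ℝ} (hh : h ∈ Set.Icc (0 : ℝ) 1) :
    ∫ t in Set.Icc (-1 : ℝ) 1, lowArcDeriv μ a κ W h t * ((1 - t ^ 2) ^ (κ - 1) : ℝ) = 0 := by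
  have hv := (integrable_one_sub_sq_rpow hκ).ofReal (𝕜 := ℂ)
  have hc : ContinuousOn (fun t : ℝ => lowArcDeriv μ a κ W h t) (Set.Icc (-1) 1) :=
    (continuousOn_lowArcDeriv μ κ ha hW).comp (f := fun t : ℝ => (h, t)) (by fun_prop)
      fun t ht => ⟨hh, ht⟩
  obtain ⟨C, hC⟩ := isCompact_Icc.exists_bound_of_continuousOn hc
  have hint : Integrable (fun t : ℝ => lowArcDeriv μ a κ W h t * ((1 - t ^ 2) ^ (κ - 1) : ℝ))
      (volume.restrict (Set.Icc (-1) 1)) :=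
    hv.bdd_mul (hc.aestronglyMeasurable measurableSet_Icc)
      ((ae_restrict_iff' measurableSet_Icc).2 (Filter.Eventually.of_forall hC))
  rw [integral_Icc_eq_integral_Ioc, ← intervalIntegral.integral_of_le (by norm_num),
    intervalIntegral.integral_eq_sub_of_hasDerivAt_of_le (by norm_num) ?_
      (fun t ht => hasDerivAt_lowArc_param hW ha hh.1 μ κ ht)]
  · simp [Real.zero_rpow hκ.ne']
  · rw [intervalIntegrable_iff_integrableOn_Icc_of_le (by norm_num)]
    exact hint
  · have hX : Continuous fun t : ℝ => W - a * lowArc h t :=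
      continuous_const.sub (continuous_const.mul
        (continuous_lowArc.comp (f := fun t : ℝ => (h, t)) (by fun_prop)))
    refine continuousOn_const.mul (((hX.continuousOn.cpow_const fun t ht =>
      mem_slitPlane_sub_lowArc hW ha hh.1 ht).mul (Continuous.continuousOn
      ((Continuous.cpow (by fun_prop) continuous_const fun p => one_add_I_mul_mem_slitPlane _ _).mul
      (Continuous.cpow (by fun_prop) continuous_const
        fun p => one_sub_I_mul_mem_slitPlane _ _)))).mul
      (Continuous.continuousOn (continuous_ofReal.comp ?_)))
    exact Continuous.rpow_const (by fun_prop) fun t => Or.inr hκ.le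

theorem integral_eq_integral_lowArc {κ : ℝ} (hκ : 0 < κ) (μ : ℝ) {a : ℝ} (ha : 0 ≤ a) {W : ℂ}
    (hW : 0 < W.im) :
    ∫ t in Set.Icc (-1 : ℝ) 1, (W - a * t) ^ (-μ : ℂ) * ((1 - t ^ 2) ^ (κ - 1) : ℝ) =
      ∫ t in Set.Icc (-1 : ℝ) 1, (W - a * lowArc 1 t) ^ (-μ : ℂ) *
        (lowArcWeight κ 1 t * ((1 - t ^ 2) ^ (κ - 1) : ℝ)) := by
  set ν := volume.restrict (Set.Icc (-1 : ℝ) 1) with hν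
  set ρ := volume.restrict (Set.Ioc (0 : ℝ) 1) with hρ
  have hv := (integrable_one_sub_sq_rpow hκ).ofReal (𝕜 := ℂ)
  set F : ℝ → ℝ → ℂ := fun h t => (W - a * lowArc h t) ^ (-μ : ℂ) * lowArcWeight κ h t with hF
  have hFint : ∀ h ∈ Set.Icc (0 : ℝ) 1,
      Integrable (fun t => F h t * ((1 - t ^ 2) ^ (κ - 1) : ℝ)) ν := by
    intro h hh
    have hc : ContinuousOn (F h) (Set.Icc (-1) 1) := fun t ht => by
      have hX : Continuous fun t : ℝ => W - a * lowArc h t :=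
        continuous_const.sub (continuous_const.mul
          (continuous_lowArc.comp (f := fun t : ℝ => (h, t)) (by fun_prop)))
      exact (hX.continuousWithinAt.cpow continuousWithinAt_const
        (mem_slitPlane_sub_lowArc hW ha hh.1 ht)).mul
        ((continuous_lowArcWeight κ).comp (f := fun t : ℝ => (h, t))
          (by fun_prop)).continuousWithinAt
    obtain ⟨C, hC⟩ := isCompact_Icc.exists_bound_of_continuousOn hc
    exact hv.bdd_mul (hc.aestronglyMeasurable measurableSet_Icc)
      ((ae_restrict_iff' measurableSet_Icc).2 (Filter.Eventually.of_forall hC))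
  have hdiff : ∀ t ∈ Set.Icc (-1 : ℝ) 1,
      F 1 t - F 0 t = ∫ h in (0 : ℝ)..1, lowArcDeriv μ a κ W h t := by
    intro t ht
    have hc : ContinuousOn (fun h : ℝ => lowArcDeriv μ a κ W h t) (Set.uIcc 0 1) := by
      rw [Set.uIcc_of_le zero_le_one]
      exact (continuousOn_lowArcDeriv μ κ ha hW).comp (f := fun h : ℝ => (h, t)) (by fun_prop)
        fun h hh => ⟨hh, ht⟩
    refine (intervalIntegral.integral_eq_sub_of_hasDerivAt (f := fun h => F h t) (fun h hh => ?_)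
      hc.intervalIntegrable).symm
    rw [Set.uIcc_of_le zero_le_one] at hh
    exact hasDerivAt_lowArc_height hW ha hh.1 μ κ ht
  have hprod : Integrable (Function.uncurry fun t h : ℝ =>
      lowArcDeriv μ a κ W h t * ((1 - t ^ 2) ^ (κ - 1) : ℝ)) (ν.prod ρ) := by
    have hc : ContinuousOn (fun p : ℝ × ℝ => lowArcDeriv μ a κ W p.2 p.1)
        (Set.Icc (-1) 1 ×ˢ Set.Icc 0 1) :=
      (continuousOn_lowArcDeriv μ κ ha hW).comp (f := Prod.swap) (by fun_prop)
        fun p hp => ⟨hp.2, hp.1⟩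
    obtain ⟨C, hC⟩ := (isCompact_Icc.prod isCompact_Icc).exists_bound_of_continuousOn hc
    have hsub : Set.Icc (-1 : ℝ) 1 ×ˢ Set.Ioc (0 : ℝ) 1 ⊆ Set.Icc (-1) 1 ×ˢ Set.Icc 0 1 :=
      Set.prod_mono le_rfl Set.Ioc_subset_Icc_self
    refine (hv.comp_fst ρ).bdd_mul (c := C) ?_ ?_
    · rw [hν, hρ, Measure.prod_restrict]
      exact (hc.mono hsub).aestronglyMeasurable (measurableSet_Icc.prod measurableSet_Ioc)
    · rw [hν, hρ, Measure.prod_restrict,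
        ae_restrict_iff' (measurableSet_Icc.prod measurableSet_Ioc)]
      exact Filter.Eventually.of_forall fun p hp => hC p (hsub hp)
  have hzero : ∫ t, (F 1 t * ((1 - t ^ 2) ^ (κ - 1) : ℝ) -
      F 0 t * ((1 - t ^ 2) ^ (κ - 1) : ℝ)) ∂ν = 0 := by
    have e : ∫ t, (F 1 t * ((1 - t ^ 2) ^ (κ - 1) : ℝ) - F 0 t * ((1 - t ^ 2) ^ (κ - 1) : ℝ)) ∂ν =
        ∫ t, ∫ h, lowArcDeriv μ a κ W h t * ((1 - t ^ 2) ^ (κ - 1) : ℝ) ∂ρ ∂ν := by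
      refine setIntegral_congr_fun measurableSet_Icc fun t ht => ?_
      rw [← sub_mul, hdiff t ht, intervalIntegral.integral_of_le zero_le_one,
        ← MeasureTheory.integral_mul_const]
    rw [e, integral_integral_swap hprod]
    refine (setIntegral_congr_fun measurableSet_Ioc fun h hh => ?_).trans
      (integral_zero ℝ ℂ)
    exact integral_lowArcDeriv hκ μ ha hW (Set.Ioc_subset_Icc_self hh)
  rw [integral_sub (hFint 1 (by simp)) (hFint 0 (by simp)), sub_eq_zero] at hzero
  simp only [hF] at hzero
  simp only [← mul_assoc]
  rw [hzero]
  refine integral_congr_ae (Filter.Eventually.of_forall fun t => ?_)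
  simp [lowArc, lowArcWeight]

theorem integrable_comp_cons {m : ℕ} {ν : Measure ℝ} [SigmaFinite ν] {f : (Fin (m + 1) → ℝ) → ℂ}
    (hf : Integrable f (Measure.pi fun _ => ν)) :
    Integrable (fun p : ℝ × (Fin m → ℝ) => f (Fin.cons p.1 p.2 : Fin (m + 1) → ℝ))
      (ν.prod (Measure.pi fun _ => ν)) := by
  have h := (measurePreserving_piFinSuccAbove (fun _ : Fin (m + 1) => ν) 0).symm
  have := (h.integrable_comp_emb (MeasurableEquiv.measurableEmbedding _)).2 hf
  refine this.congr (Filter.Eventually.of_forall fun p => ?_)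
  simp [MeasurableEquiv.piFinSuccAbove, Fin.insertNthEquiv]

theorem integral_eq_integral_cons {m : ℕ} {ν : Measure ℝ} [SigmaFinite ν]
    {f : (Fin (m + 1) → ℝ) → ℂ} (hf : Integrable f (Measure.pi fun _ => ν)) :
    ∫ t, f t ∂(Measure.pi fun _ => ν) =
      ∫ x, ∫ y, f (Fin.cons x y : Fin (m + 1) → ℝ) ∂(Measure.pi fun _ : Fin m => ν) ∂ν := by
  have h := (measurePreserving_piFinSuccAbove (fun _ : Fin (m + 1) => ν) 0).symm
  rw [← integral_prod _ (integrable_comp_cons hf), ← h.integral_comp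
    (MeasurableEquiv.measurableEmbedding _)]
  refine integral_congr_ae (Filter.Eventually.of_forall fun p => ?_)
  simp [MeasurableEquiv.piFinSuccAbove, Fin.insertNthEquiv]

theorem norm_cpow_neg_le {μ y : ℝ} (hμ : 0 ≤ μ) (hy : 0 < y) {X : ℂ} (hX : y ≤ ‖X‖) :
    ‖X ^ (-μ : ℂ)‖ ≤ y ^ (-μ) := by
  rw [← ofReal_neg, norm_cpow_real]
  exact Real.rpow_le_rpow_of_nonpos hy hX (by linarith)

theorem le_im_sub_sum {ι : Type*} [Fintype ι] {p : ι → ℝ → ℂ} {t : ι → ℝ}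
    (him : ∀ j, (p j (t j)).im ≤ 0) {a : ι → ℝ} (ha : ∀ j, 0 ≤ a j) (W : ℂ) :
    W.im ≤ (W - ∑ j, a j * p j (t j)).im := by
  rw [sub_im, im_sum]
  have : ∑ j, (a j * p j (t j) : ℂ).im ≤ 0 := Finset.sum_nonpos fun j _ => by
    rw [im_ofReal_mul]
    exact mul_nonpos_of_nonneg_of_nonpos (ha j) (him j)
  linarith

theorem ae_pi_restrict_Icc (ι : Type*) [Fintype ι] :
    ∀ᵐ t : ι → ℝ ∂(Measure.pi fun _ => volume.restrict (Set.Icc (-1 : ℝ) 1)),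
      ∀ j, t j ∈ Set.Icc (-1 : ℝ) 1 := by
  rw [← Measure.restrict_pi_pi, ae_restrict_iff' (MeasurableSet.univ_pi fun _ => measurableSet_Icc)]
  exact Filter.Eventually.of_forall fun t ht j => ht j (Set.mem_univ j)

theorem integrable_cpow_mul_prod {ι : Type*} [Fintype ι] {p : ι → ℝ → ℂ}
    (hp : ∀ j, Measurable (p j)) (him : ∀ j, ∀ t ∈ Set.Icc (-1 : ℝ) 1, (p j t).im ≤ 0)
    {u : ι → ℝ → ℂ} (hu : ∀ j, Integrable (u j) (volume.restrict (Set.Icc (-1) 1)))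
    {a : ι → ℝ} (ha : ∀ j, 0 ≤ a j) {μ : ℝ} (hμ : 0 ≤ μ) {W : ℂ} (hW : 0 < W.im) :
    Integrable (fun t : ι → ℝ => (W - ∑ j, a j * p j (t j)) ^ (-μ : ℂ) * ∏ j, u j (t j))
      (Measure.pi fun _ => volume.restrict (Set.Icc (-1) 1)) := by
  refine (Integrable.fintype_prod hu).bdd_mul (c := W.im ^ (-μ)) ?_ ?_
  · have : Measurable fun t : ι → ℝ => W - ∑ j, a j * p j (t j) :=
      measurable_const.sub (Finset.measurable_sum _ fun j _ =>
        ((hp j).comp (measurable_pi_apply j)).const_mul _)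
    exact (this.pow_const _).aestronglyMeasurable
  · filter_upwards [ae_pi_restrict_Icc ι] with t ht
    exact norm_cpow_neg_le hμ hW ((le_im_sub_sum (fun j => him j _ (ht j)) ha W).trans
      ((le_abs_self _).trans (abs_im_le_norm _)))

theorem integrable_lowArcWeight {κ : ℝ} (hκ : 0 < κ) :
    Integrable (fun t => lowArcWeight κ 1 t * ((1 - t ^ 2) ^ (κ - 1) : ℝ))
      (volume.restrict (Set.Icc (-1) 1)) := by
  have hc : Continuous (lowArcWeight κ 1) :=
    (continuous_lowArcWeight κ).comp (f := fun t : ℝ => ((1 : ℝ), t)) (by fun_prop)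
  obtain ⟨C, hC⟩ := isCompact_Icc.exists_bound_of_continuousOn (s := Set.Icc (-1 : ℝ) 1)
    hc.continuousOn
  exact (integrable_one_sub_sq_rpow hκ).ofReal.bdd_mul hc.aestronglyMeasurable
    ((ae_restrict_iff' measurableSet_Icc).2 (Filter.Eventually.of_forall hC))

theorem integral_pi_eq_integral_lowArc {μ : ℝ} (hμ : 0 ≤ μ) {m : ℕ} {κ : Fin m → ℝ}
    (hκ : ∀ j, 0 < κ j) {a : Fin m → ℝ} (ha : ∀ j, 0 ≤ a j) {W : ℂ} (hW : 0 < W.im) :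
    ∫ t : Fin m → ℝ, (W - ∑ j, a j * (t j : ℂ)) ^ (-μ : ℂ) *
        ∏ j, (((1 - t j ^ 2) ^ (κ j - 1) : ℝ) : ℂ)
        ∂(Measure.pi fun _ => volume.restrict (Set.Icc (-1) 1)) =
      ∫ t : Fin m → ℝ, (W - ∑ j, a j * lowArc 1 (t j)) ^ (-μ : ℂ) *
        ∏ j, (lowArcWeight (κ j) 1 (t j) * ((1 - t j ^ 2) ^ (κ j - 1) : ℝ))
        ∂(Measure.pi fun _ => volume.restrict (Set.Icc (-1) 1)) := by
  induction m generalizing W with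
  | zero => simp
  | succ m ih =>
    have hmeas : Measurable (lowArc 1) := by unfold lowArc; fun_prop
    have him : ∀ t ∈ Set.Icc (-1 : ℝ) 1, (lowArc 1 t).im ≤ 0 := fun t ht => by
      rw [lowArc_im]; nlinarith [ht.1, ht.2]
    have hw : ∀ j, Integrable (fun t : ℝ => (((1 - t ^ 2) ^ (κ j - 1) : ℝ) : ℂ))
        (volume.restrict (Set.Icc (-1) 1)) := fun j => (integrable_one_sub_sq_rpow (hκ j)).ofReal
    have hl := fun j => integrable_lowArcWeight (hκ j)
    have i1 := integrable_cpow_mul_prod (p := fun _ t => (t : ℂ)) (fun _ => by fun_prop)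
      (by simp) hw ha hμ hW
    have i2 := integrable_cpow_mul_prod
      (p := (Fin.cons (fun t => (t : ℂ)) fun _ => lowArc 1 : Fin (m + 1) → ℝ → ℂ))
      (Fin.cases (by simp only [Fin.cons_zero]; fun_prop) fun _ => hmeas)
      (Fin.cases (by simp) fun _ => him)
      (u := (Fin.cons (fun t => (((1 - t ^ 2) ^ (κ 0 - 1) : ℝ) : ℂ)) fun j t =>
        lowArcWeight (κ j.succ) 1 t * ((1 - t ^ 2) ^ (κ j.succ - 1) : ℝ) : Fin (m + 1) → ℝ → ℂ))
      (Fin.cases (hw 0) fun j => hl j.succ) ha hμ hW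
    have i3 := integrable_cpow_mul_prod (p := fun _ => lowArc 1) (fun _ => hmeas)
      (fun _ => him) hl ha hμ hW
    have e3 := integral_eq_integral_cons i3
    rw [integral_integral_swap (integrable_comp_cons i3)] at e3
    rw [integral_eq_integral_cons i1, e3]
    have i2' := integrable_comp_cons i2
    simp only [Fin.sum_univ_succ, Fin.prod_univ_succ, Fin.cons_zero, Fin.cons_succ] at i2' ⊢
    calc _ = ∫ x : ℝ, ∫ y : Fin m → ℝ,
        (W - (a 0 * (x : ℂ) + ∑ j, a j.succ * lowArc 1 (y j))) ^ (-μ : ℂ) *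
        ((((1 - x ^ 2) ^ (κ 0 - 1) : ℝ) : ℂ) * ∏ j, (lowArcWeight (κ j.succ) 1 (y j) *
          ((1 - y j ^ 2) ^ (κ j.succ - 1) : ℝ)))
        ∂(Measure.pi fun _ => volume.restrict (Set.Icc (-1) 1))
        ∂(volume.restrict (Set.Icc (-1) 1)) := by
          refine integral_congr_ae (Filter.Eventually.of_forall fun x => ?_)
          have := ih (fun j => hκ j.succ) (fun j => ha j.succ) (W := W - a 0 * x) (by simpa)
          simp only [mul_left_comm _ (((1 - x ^ 2) ^ (κ 0 - 1) : ℝ) : ℂ),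
            MeasureTheory.integral_const_mul, ← sub_sub, this]
      _ = _ := by
          rw [integral_integral_swap i2']
          refine integral_congr_ae ?_
          filter_upwards [ae_pi_restrict_Icc (Fin m)] with y hy
          have hW' := hW.trans_le (le_im_sub_sum (p := fun _ => lowArc 1) (t := y)
            (fun j => him _ (hy j)) (fun j => ha j.succ) W)
          have := integral_eq_integral_lowArc (hκ 0) μ (ha 0) hW'
          simp only [← mul_assoc, MeasureTheory.integral_mul_const] at this ⊢
          simp only [add_comm (_ * _ : ℂ) (∑ j, _), ← sub_sub]
          rw [this]

theorem integral_rpow_mul_add_mul_rpow_le {κ e δ a : ℝ} (hκ : 0 < κ) (he : κ < e) (hδ : 0 < δ)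
    (ha : 0 ≤ a) :
    IntervalIntegrable (fun s : ℝ => s ^ (κ - 1) * (δ + a * s) ^ (-e)) volume 0 1 ∧
    ∫ s in (0 : ℝ)..1, s ^ (κ - 1) * (δ + a * s) ^ (-e) ≤
      2 ^ κ * (1 / κ + 1 / (e - κ)) * (δ ^ (-(e - κ)) * (δ + a) ^ (-κ)) := by
  have hbase : IntervalIntegrable (fun s : ℝ => s ^ (κ - 1)) volume 0 1 :=
    intervalIntegral.intervalIntegrable_rpow' (by linarith)
  have hcont : ContinuousOn (fun s : ℝ => (δ + a * s) ^ (-e)) (Set.uIcc 0 1) := by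
    rw [Set.uIcc_of_le zero_le_one]
    refine ContinuousOn.rpow_const (by fun_prop) fun s hs => Or.inl ?_
    have := mul_nonneg ha hs.1
    positivity
  have hint := hbase.mul_continuousOn hcont
  refine ⟨hint, ?_⟩
  have hle1 : ∀ s ∈ Set.Icc (0 : ℝ) 1,
      s ^ (κ - 1) * (δ + a * s) ^ (-e) ≤ δ ^ (-e) * s ^ (κ - 1) := fun s hs => by
    rw [mul_comm]
    have := mul_nonneg ha hs.1
    gcongr ?_ * _
    · exact Real.rpow_nonneg hs.1 _
    · exact Real.rpow_le_rpow_of_nonpos hδ (by linarith) (by linarith)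
  have hpow : ∀ c : ℝ, ∫ s in (0 : ℝ)..c, s ^ (κ - 1) = c ^ κ / κ := fun c => by
    rw [integral_rpow (Or.inl (by linarith)), sub_add_cancel, Real.zero_rpow hκ.ne', sub_zero]
  have heκ : 0 < e - κ := by linarith
  have hδe : δ ^ (-e) = δ ^ (-(e - κ)) * δ ^ (-κ) := by
    rw [← Real.rpow_add hδ]; ring_nf
  have htwo : ∀ b : ℝ, 0 < b → δ + a ≤ 2 * b → b ^ (-κ) ≤ 2 ^ κ * (δ + a) ^ (-κ) := by
    intro b hb hab
    have h1 : (2 * b) ^ (-κ) ≤ (δ + a) ^ (-κ) :=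
      Real.rpow_le_rpow_of_nonpos (by linarith) hab (by linarith)
    rw [Real.mul_rpow two_pos.le hb.le] at h1
    calc b ^ (-κ) = 2 ^ κ * (2 ^ (-κ) * b ^ (-κ)) := by
          rw [← mul_assoc, ← Real.rpow_add two_pos]; simp
      _ ≤ _ := by gcongr
  rcases le_or_gt a δ with hle | hlt
  · calc _ ≤ ∫ s in (0 : ℝ)..1, δ ^ (-e) * s ^ (κ - 1) :=
          intervalIntegral.integral_mono_on zero_le_one hint (hbase.const_mul _) hle1
      _ = δ ^ (-(e - κ)) * δ ^ (-κ) * (1 / κ) := by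
          rw [intervalIntegral.integral_const_mul, hpow, Real.one_rpow, hδe]
      _ ≤ δ ^ (-(e - κ)) * (2 ^ κ * (δ + a) ^ (-κ)) * (1 / κ + 1 / (e - κ)) := by
          gcongr
          · exact htwo δ hδ (by linarith)
          · have : 0 < 1 / (e - κ) := by positivity
            linarith
      _ = _ := by ring
  · have ha0 : 0 < a := hδ.trans hlt
    set c := δ / a with hc
    have hc0 : 0 < c := by positivity
    have hc1 : c ≤ 1 := (div_le_one ha0).2 hlt.le
    have hs1 : Set.uIcc 0 c ⊆ Set.uIcc (0 : ℝ) 1 := by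
      rw [Set.uIcc_of_le hc0.le, Set.uIcc_of_le zero_le_one]
      exact Set.Icc_subset_Icc le_rfl hc1
    have hs2 : Set.uIcc c 1 ⊆ Set.uIcc (0 : ℝ) 1 := by
      rw [Set.uIcc_of_le hc1, Set.uIcc_of_le zero_le_one]
      exact Set.Icc_subset_Icc hc0.le le_rfl
    have h0c : (0 : ℝ) ∉ Set.uIcc c 1 := by
      rw [Set.uIcc_of_le hc1]; exact fun h => absurd h.1 (not_le.2 hc0)
    have hle2 : ∀ s ∈ Set.Icc c 1,
        s ^ (κ - 1) * (δ + a * s) ^ (-e) ≤ a ^ (-e) * s ^ (κ - 1 - e) := fun s hs => by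
      have hs0 : 0 < s := hc0.trans_le hs.1
      have : (δ + a * s) ^ (-e) ≤ a ^ (-e) * s ^ (-e) := by
        rw [← Real.mul_rpow ha hs0.le]
        exact Real.rpow_le_rpow_of_nonpos (by positivity) (by linarith) (by linarith)
      calc _ ≤ s ^ (κ - 1) * (a ^ (-e) * s ^ (-e)) := by gcongr
        _ = _ := by rw [sub_eq_add_neg (κ - 1), Real.rpow_add hs0]; ring
    have hc_rpow : ∀ p : ℝ, c ^ p = δ ^ p * a ^ (-p) := fun p => by
      rw [hc, Real.div_rpow hδ.le ha, Real.rpow_neg ha, div_eq_mul_inv]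
    have e1 : δ ^ (-e) * c ^ κ = δ ^ (-(e - κ)) * a ^ (-κ) := by
      rw [hc_rpow, ← mul_assoc, ← Real.rpow_add hδ]; ring_nf
    have e2 : a ^ (-e) * c ^ (κ - e) = δ ^ (-(e - κ)) * a ^ (-κ) := by
      rw [hc_rpow, mul_left_comm, ← Real.rpow_add ha0]; ring_nf
    have hrp : IntervalIntegrable (fun s : ℝ => s ^ (κ - 1 - e)) volume c 1 :=
      intervalIntegral.intervalIntegrable_rpow (Or.inr h0c)
    have i2 : ∫ s in c..1, s ^ (κ - 1 - e) ≤ c ^ (κ - e) * (1 / (e - κ)) := by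
      rw [integral_rpow (Or.inr ⟨by linarith, h0c⟩), Real.one_rpow,
        show κ - 1 - e + 1 = -(e - κ) by ring, div_neg, ← neg_div, neg_sub, neg_sub, mul_one_div]
      gcongr
      linarith
    rw [← intervalIntegral.integral_add_adjacent_intervals (hint.mono_set hs1)
      (hint.mono_set hs2)]
    calc _ ≤ (∫ s in (0 : ℝ)..c, δ ^ (-e) * s ^ (κ - 1)) +
          ∫ s in c..1, a ^ (-e) * s ^ (κ - 1 - e) :=
          add_le_add (intervalIntegral.integral_mono_on hc0.le (hint.mono_set hs1)
            ((hbase.mono_set hs1).const_mul _) fun s hs => hle1 s ⟨hs.1, hs.2.trans hc1⟩)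
          (intervalIntegral.integral_mono_on hc1 (hint.mono_set hs2) (hrp.const_mul _) hle2)
      _ ≤ δ ^ (-e) * (c ^ κ / κ) + a ^ (-e) * (c ^ (κ - e) * (1 / (e - κ))) := by
          rw [intervalIntegral.integral_const_mul, intervalIntegral.integral_const_mul, hpow]
          gcongr
      _ = δ ^ (-(e - κ)) * a ^ (-κ) * (1 / κ + 1 / (e - κ)) := by
          linear_combination (1 / κ) * e1 + (1 / (e - κ)) * e2
      _ ≤ δ ^ (-(e - κ)) * (2 ^ κ * (δ + a) ^ (-κ)) * (1 / κ + 1 / (e - κ)) := by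
          gcongr
          exact htwo a ha0 (by linarith)
      _ = _ := by ring

theorem integral_one_sub_sq_rpow_mul_le {κ e δ a : ℝ} (hκ : 0 < κ) (he : κ < e) (hδ : 0 < δ)
    (ha : 0 ≤ a) :
    ∫ t in Set.Icc (-1 : ℝ) 1, (1 - t ^ 2) ^ (κ - 1) * (δ + a * (1 - t ^ 2)) ^ (-e) ≤
      2 * (2 ^ κ * (2 ^ κ * (1 / κ + 1 / (e - κ)))) * (δ ^ (-(e - κ)) * (δ + a) ^ (-κ)) := by
  set f : ℝ → ℝ := fun t => (1 - t ^ 2) ^ (κ - 1) * (δ + a * (1 - t ^ 2)) ^ (-e) with hf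
  have hsub : Set.uIcc (0 : ℝ) 1 ⊆ Set.uIcc (-1) 1 := by
    rw [Set.uIcc_of_le (by norm_num), Set.uIcc_of_le (by norm_num)]
    exact Set.Icc_subset_Icc (by norm_num) le_rfl
  have hsub' : Set.uIcc (-1 : ℝ) 0 ⊆ Set.uIcc (-1) 1 := by
    rw [Set.uIcc_of_le (by norm_num), Set.uIcc_of_le (by norm_num)]
    exact Set.Icc_subset_Icc le_rfl (by norm_num)
  have hint : IntervalIntegrable f volume (-1) 1 := by
    refine (intervalIntegrable_one_sub_sq_rpow (by linarith)).mul_continuousOn ?_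
    rw [Set.uIcc_of_le (by norm_num)]
    refine ContinuousOn.rpow_const (by fun_prop) fun s hs => Or.inl ?_
    have : 0 ≤ a * (1 - s ^ 2) := mul_nonneg ha (by nlinarith [hs.1, hs.2])
    positivity
  have heven : ∫ t in (-1 : ℝ)..1, f t = 2 * ∫ t in (0 : ℝ)..1, f t := by
    rw [← intervalIntegral.integral_add_adjacent_intervals (hint.mono_set hsub')
      (hint.mono_set hsub)]
    have e := intervalIntegral.integral_comp_neg (a := 0) (b := 1) f
    rw [neg_zero] at e
    rw [← e, two_mul]
    simp [hf]
  obtain ⟨hi, hle⟩ := integral_rpow_mul_add_mul_rpow_le hκ he hδ ha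
  have hi' : IntervalIntegrable
      (fun t : ℝ => (1 - t) ^ (κ - 1) * (δ + a * (1 - t)) ^ (-e)) volume 0 1 := by
    have := (hi.comp_sub_left 1).symm
    simpa using this
  rw [integral_Icc_eq_integral_Ioc, ← intervalIntegral.integral_of_le (by norm_num), heven]
  calc _ ≤ 2 * ∫ t in (0 : ℝ)..1, 2 ^ κ * ((1 - t) ^ (κ - 1) * (δ + a * (1 - t)) ^ (-e)) := by
        gcongr
        refine intervalIntegral.integral_mono_on_of_le_Ioo zero_le_one (hint.mono_set hsub)
          (hi'.const_mul _) fun t ht => ?_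
        have h1 : 0 < 1 - t := by linarith [ht.2]
        have h2 : 1 - t ≤ 1 - t ^ 2 := by nlinarith [ht.1, ht.2]
        have h3 : 1 - t ^ 2 ≤ 2 * (1 - t) := by nlinarith [ht.1, ht.2]
        have h4 : 0 < 1 - t ^ 2 := by linarith
        rw [hf, ← mul_assoc]
        gcongr ?_ * ?_
        · calc (1 - t ^ 2) ^ (κ - 1) = (1 - t ^ 2) ^ κ / (1 - t ^ 2) := by
                rw [Real.rpow_sub_one h4.ne']
            _ ≤ (2 * (1 - t)) ^ κ / (1 - t) := by gcongr
            _ = _ := by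
                rw [Real.mul_rpow two_pos.le h1.le, mul_div_assoc, ← Real.rpow_sub_one h1.ne']
        · refine Real.rpow_le_rpow_of_nonpos ?_ ?_ (by linarith)
          · positivity
          · gcongr
    _ = 2 * (2 ^ κ * ∫ s in (0 : ℝ)..1, s ^ (κ - 1) * (δ + a * s) ^ (-e)) := by
        rw [intervalIntegral.integral_const_mul]
        congr 2
        have := intervalIntegral.integral_comp_sub_left (a := 0) (b := 1)
          (fun s : ℝ => s ^ (κ - 1) * (δ + a * s) ^ (-e)) 1
        simpa using this
    _ ≤ 2 * (2 ^ κ * (2 ^ κ * (1 / κ + 1 / (e - κ)) * (δ ^ (-(e - κ)) * (δ + a) ^ (-κ)))) := by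
        gcongr
    _ = _ := by ring

theorem add_sum_le_norm_sub_lowArc {ι : Type*} [Fintype ι] {a : ι → ℝ} (ha : ∀ j, 0 ≤ a j)
    {W : ℂ} (hW : 0 < W.im) {δ : ℝ}
    (hδ : ∀ ε : ι → ℝ, (∀ j, ε j = 1 ∨ ε j = -1) → δ ≤ ‖W - ∑ j, (a j * ε j : ℂ)‖)
    {t : ι → ℝ} (ht : ∀ j, t j ∈ Set.Icc (-1 : ℝ) 1) :
    δ + ∑ j, a j * (1 - t j ^ 2) ≤ 4 * ‖W - ∑ j, a j * lowArc 1 (t j)‖ := by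
  set X := W - ∑ j, a j * lowArc 1 (t j) with hX
  have hu : ∀ j, 0 ≤ 1 - t j ^ 2 := fun j => by nlinarith [(ht j).1, (ht j).2]
  have hU : ∑ j, a j * (1 - t j ^ 2) ≤ ‖X‖ := by
    refine le_trans ?_ ((le_abs_self _).trans (abs_im_le_norm X))
    rw [hX, sub_im, im_sum]
    simp only [im_ofReal_mul, lowArc_im, one_mul, mul_neg, Finset.sum_neg_distrib]
    linarith
  set ε : ι → ℝ := fun j => if 0 ≤ t j then 1 else -1 with hε
  have h1 := hδ ε fun j => by by_cases h : 0 ≤ t j <;> simp [hε, h]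
  have h2 : ‖∑ j, a j * (lowArc 1 (t j) - ε j)‖ ≤ 2 * ∑ j, a j * (1 - t j ^ 2) := by
    rw [Finset.mul_sum]
    refine norm_sum_le_of_le _ fun j _ => ?_
    rw [norm_mul, norm_real, Real.norm_of_nonneg (ha j), mul_left_comm]
    have h3 : ‖lowArc 1 (t j) - ε j‖ ≤ 2 * (1 - t j ^ 2) := by
      have e : lowArc 1 (t j) - ε j = ((t j - ε j : ℝ) : ℂ) - I * ((1 - t j ^ 2 : ℝ) : ℂ) := by
        simp [lowArc]; ring
      have h4 : |t j - ε j| ≤ 1 - t j ^ 2 := by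
        obtain ⟨l, r⟩ := ht j
        by_cases h : 0 ≤ t j
        · simp only [hε, h, if_true]; rw [abs_le]; constructor <;> nlinarith
        · simp only [hε, h, if_false]; rw [abs_le]; constructor <;> nlinarith
      rw [e]
      refine (norm_sub_le _ _).trans ?_
      rw [norm_mul, norm_I, norm_real, norm_real, Real.norm_eq_abs, Real.norm_of_nonneg (hu j)]
      linarith
    exact mul_le_mul_of_nonneg_left h3 (ha j)
  have h5 : W - ∑ j, (a j * ε j : ℂ) = X + ∑ j, a j * (lowArc 1 (t j) - ε j) := by
    simp only [hX, mul_sub, Finset.sum_sub_distrib]; ring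
  have h6 := norm_add_le X (∑ j, a j * (lowArc 1 (t j) - ε j))
  rw [h5] at h1
  linarith

theorem exists_norm_integral_cpow_le {m : ℕ} {κ : Fin (m + 1) → ℝ} (hκ : ∀ j, 0 < κ j) {μ : ℝ}
    (hμ : ∑ j, κ j < μ) :
    ∃ C : ℝ, 0 < C ∧ ∀ a : Fin (m + 1) → ℝ, (∀ j, 0 ≤ a j) → ∀ W : ℂ, 0 < W.im → ∀ δ : ℝ, 0 < δ →
      (∀ ε : Fin (m + 1) → ℝ, (∀ j, ε j = 1 ∨ ε j = -1) → δ ≤ ‖W - ∑ j, (a j * ε j : ℂ)‖) →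
      ‖∫ t : Fin (m + 1) → ℝ, (W - ∑ j, a j * (t j : ℂ)) ^ (-μ : ℂ) *
          ∏ j, (((1 - t j ^ 2) ^ (κ j - 1) : ℝ) : ℂ)
          ∂(Measure.pi fun _ => volume.restrict (Set.Icc (-1) 1))‖ ≤
        C * (δ ^ (-(μ - ∑ j, κ j)) * ∏ j, (δ + a j) ^ (-κ j)) := by
  have hμ0 : 0 < μ := (Finset.sum_nonneg fun j _ => (hκ j).le).trans_lt hμ
  set s : ℝ := (μ - ∑ j, κ j) / (m + 1) with hs
  have hs0 : 0 < s := div_pos (by linarith) (by positivity)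
  have hsum : ∑ j, (κ j + s) = μ := by
    rw [Finset.sum_add_distrib]
    simp [hs]
    field_simp
    ring
  have hB : ∀ j, ∃ B : ℝ, 0 < B ∧ ∀ t ∈ Set.Icc (-1 : ℝ) 1, ‖lowArcWeight (κ j) 1 t‖ ≤ B := by
    intro j
    have hc : Continuous (lowArcWeight (κ j) 1) :=
      (continuous_lowArcWeight (κ j)).comp (f := fun t : ℝ => ((1 : ℝ), t)) (by fun_prop)
    obtain ⟨C, hC⟩ := isCompact_Icc.exists_bound_of_continuousOn (s := Set.Icc (-1 : ℝ) 1)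
      hc.continuousOn
    exact ⟨max C 1, by positivity, fun t ht => (hC t ht).trans (le_max_left _ _)⟩
  choose B hB0 hB using hB
  set D : Fin (m + 1) → ℝ := fun j => 2 * (2 ^ κ j * (2 ^ κ j * (1 / κ j + 1 / s))) with hD
  have hD0 : ∀ j, 0 < D j := fun j => by have := hκ j; simp only [hD]; positivity
  refine ⟨4 ^ μ * ∏ j, (B j * D j), by
    have := Finset.prod_pos fun j (_ : j ∈ Finset.univ) => mul_pos (hB0 j) (hD0 j)
    positivity, fun a ha W hW δ hδ hcor => ?_⟩
  rw [integral_pi_eq_integral_lowArc hμ0.le hκ ha hW]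
  set g : Fin (m + 1) → ℝ → ℝ := fun j t =>
    (1 - t ^ 2) ^ (κ j - 1) * (δ + a j * (1 - t ^ 2)) ^ (-(κ j + s)) with hg
  have hgint : ∀ j, Integrable (g j) (volume.restrict (Set.Icc (-1) 1)) := by
    intro j
    have hc : ContinuousOn (fun t : ℝ => (δ + a j * (1 - t ^ 2)) ^ (-(κ j + s)))
        (Set.Icc (-1) 1) := by
      refine ContinuousOn.rpow_const (by fun_prop) fun t ht => Or.inl ?_
      have : 0 ≤ a j * (1 - t ^ 2) := mul_nonneg (ha j) (by nlinarith [ht.1, ht.2])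
      positivity
    obtain ⟨C, hC⟩ := isCompact_Icc.exists_bound_of_continuousOn hc
    exact (integrable_one_sub_sq_rpow (hκ j)).mul_bdd (c := C)
      (hc.aestronglyMeasurable measurableSet_Icc)
      ((ae_restrict_iff' measurableSet_Icc).2 (Filter.Eventually.of_forall hC))
  have hpt : ∀ t : Fin (m + 1) → ℝ, (∀ j, t j ∈ Set.Icc (-1 : ℝ) 1) →
      ‖(W - ∑ j, a j * lowArc 1 (t j)) ^ (-μ : ℂ) *
        ∏ j, (lowArcWeight (κ j) 1 (t j) * ((1 - t j ^ 2) ^ (κ j - 1) : ℝ))‖ ≤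
      4 ^ μ * (∏ j, B j) * ∏ j, g j (t j) := by
    intro t ht
    have hu : ∀ j, 0 ≤ 1 - t j ^ 2 := fun j => by nlinarith [(ht j).1, (ht j).2]
    have hau : ∀ j, 0 ≤ a j * (1 - t j ^ 2) := fun j => mul_nonneg (ha j) (hu j)
    have hU : 0 ≤ ∑ j, a j * (1 - t j ^ 2) := Finset.sum_nonneg fun j _ => hau j
    have h1 := add_sum_le_norm_sub_lowArc ha hW hcor ht
    have hpos : 0 < δ + ∑ j, a j * (1 - t j ^ 2) := by linarith
    have h2 : ‖(W - ∑ j, a j * lowArc 1 (t j)) ^ (-μ : ℂ)‖ ≤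
        4 ^ μ * ∏ j, (δ + a j * (1 - t j ^ 2)) ^ (-(κ j + s)) := by
      refine (norm_cpow_neg_le (y := 4⁻¹ * (δ + ∑ j, a j * (1 - t j ^ 2))) hμ0.le (by positivity)
        (by linarith)).trans ?_
      rw [Real.mul_rpow (by norm_num) hpos.le, Real.inv_rpow (by norm_num),
        Real.rpow_neg (by norm_num), inv_inv]
      gcongr
      rw [← hsum, ← Finset.sum_neg_distrib, Real.rpow_sum_of_pos hpos]
      refine Finset.prod_le_prod (fun j _ => by positivity) fun j _ => ?_
      refine Real.rpow_le_rpow_of_nonpos (by linarith [hau j]) ?_ (by linarith [hκ j])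
      have := Finset.single_le_sum (f := fun j => a j * (1 - t j ^ 2)) (fun j _ => hau j)
        (Finset.mem_univ j)
      linarith
    rw [norm_mul, norm_prod]
    calc _ ≤ (4 ^ μ * ∏ j, (δ + a j * (1 - t j ^ 2)) ^ (-(κ j + s))) *
          ∏ j, (B j * (1 - t j ^ 2) ^ (κ j - 1)) := by
          refine mul_le_mul h2 (Finset.prod_le_prod (fun j _ => norm_nonneg _) fun j _ => ?_)
            (Finset.prod_nonneg fun j _ => norm_nonneg _) ((norm_nonneg _).trans h2)
          rw [norm_mul, norm_real, Real.norm_of_nonneg (Real.rpow_nonneg (hu j) _)]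
          exact mul_le_mul_of_nonneg_right (hB j _ (ht j)) (Real.rpow_nonneg (hu j) _)
      _ = _ := by simp only [hg, Finset.prod_mul_distrib]; ring
  calc _ ≤ ∫ t : Fin (m + 1) → ℝ, 4 ^ μ * (∏ j, B j) * ∏ j, g j (t j)
        ∂(Measure.pi fun _ => volume.restrict (Set.Icc (-1) 1)) := by
        refine norm_integral_le_of_norm_le ((Integrable.fintype_prod hgint).const_mul _) ?_
        filter_upwards [ae_pi_restrict_Icc (Fin (m + 1))] with t ht
        exact hpt t ht
    _ = 4 ^ μ * (∏ j, B j) * ∏ j, ∫ t in Set.Icc (-1 : ℝ) 1, g j t := by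
        rw [MeasureTheory.integral_const_mul, integral_fintype_prod_eq_prod]
    _ ≤ 4 ^ μ * (∏ j, B j) * ∏ j, (D j * (δ ^ (-s) * (δ + a j) ^ (-κ j))) := by
        have := Finset.prod_nonneg fun j (_ : j ∈ Finset.univ) => (hB0 j).le
        refine mul_le_mul_of_nonneg_left (Finset.prod_le_prod (fun j _ => ?_) fun j _ => ?_)
          (by positivity)
        · refine setIntegral_nonneg measurableSet_Icc fun t ht => ?_
          have hu : 0 ≤ 1 - t ^ 2 := by nlinarith [ht.1, ht.2]
          have := mul_nonneg (ha j) hu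
          simp only [hg]
          positivity
        · have := integral_one_sub_sq_rpow_mul_le (hκ j) (e := κ j + s) (by linarith) hδ (ha j)
          rwa [add_sub_cancel_left] at this
    _ = _ := by
        have : ∏ _j : Fin (m + 1), δ ^ (-s) = δ ^ (-(μ - ∑ j, κ j)) := by
          rw [Finset.prod_const, ← Real.rpow_natCast, ← Real.rpow_mul hδ.le, hs]
          congr 1
          simp
          field_simp
          ring
        rw [← this]
        simp only [Finset.prod_mul_distrib]
        ring

end ContourShift

section GeneratingFunction

open Complex

theorem mul_cpow_of_arg_add {x y : ℂ} (hx : x ≠ 0) (hy : y ≠ 0)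
    (h : x.arg + y.arg ∈ Set.Ioc (-π) π) (c : ℂ) : (x * y) ^ c = x ^ c * y ^ c := by
  rw [cpow_def_of_ne_zero (mul_ne_zero hx hy), cpow_def_of_ne_zero hx, cpow_def_of_ne_zero hy,
    log_mul hx hy h, ← Complex.exp_add]
  ring_nf

theorem genQuad_eq_mul {r : ℂ} (hr : r ≠ 0) (z : ℝ) :
    genQuad z r = 2 * r * ((r + r⁻¹) / 2 - z) := by
  unfold genQuad
  field_simp
  ring

theorem im_add_inv_pos {r : ℂ} (hr : ‖r‖ < 1) (him : r.im < 0) : 0 < ((r + r⁻¹) / 2).im := by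
  have h0 : 0 < normSq r := normSq_pos.2 fun h => by simp [h] at him
  have h1 : normSq r < 1 := by
    rw [normSq_eq_norm_sq]
    nlinarith [norm_nonneg r]
  have h2 : ((r + r⁻¹) / 2).im = (r.im - r.im / normSq r) / 2 := by
    rw [show (r + r⁻¹) / 2 = ((1 / 2 : ℝ) : ℂ) * (r + r⁻¹) by push_cast; ring, im_ofReal_mul,
      add_im, inv_im]
    ring
  have h3 : r.im / normSq r < r.im := by
    rw [div_lt_iff₀ h0]
    nlinarith
  rw [h2]
  linarith

theorem genQuad_cpow_eq_mul {r : ℂ} (hr : ‖r‖ < 1) (him : r.im < 0) (z : ℝ) (c : ℂ) :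
    genQuad z r ^ c = (2 * r) ^ c * ((r + r⁻¹) / 2 - z) ^ c := by
  have h0 : r ≠ 0 := fun h => by simp [h] at him
  have hW : 0 < ((r + r⁻¹) / 2 - z).im := by
    rw [sub_im, ofReal_im, sub_zero]
    exact im_add_inv_pos hr him
  rw [genQuad_eq_mul h0]
  refine mul_cpow_of_arg_add (by simpa using h0) (fun h => by simp [h] at hW) ?_ c
  have h1 : (2 * r).arg < 0 := arg_neg_iff.2 (by simp; linarith)
  have h2 := arg_nonneg_iff.2 hW.le
  exact ⟨by linarith [neg_pi_lt_arg (2 * r)], by linarith [arg_le_pi ((r + r⁻¹) / 2 - z)]⟩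

theorem conj_genQuad (z : ℝ) (r : ℂ) :
    (starRingEnd ℂ) (genQuad z r) = genQuad z ((starRingEnd ℂ) r) := by
  simp [genQuad, Complex.conj_ofNat]

theorem abs_sum_mul_le {ι : Type*} [Fintype ι] {a t : ι → ℝ} (ha : ∀ j, 0 ≤ a j)
    (ha1 : ∑ j, a j ≤ 1) (ht : ∀ j, t j ∈ Set.Icc (-1 : ℝ) 1) : |∑ j, a j * t j| ≤ 1 := by
  refine (Finset.abs_sum_le_sum_abs _ _).trans ((Finset.sum_le_sum fun j _ => ?_).trans ha1)
  rw [abs_mul, abs_of_nonneg (ha j)]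
  exact mul_le_of_le_one_right (ha j) (abs_le.2 (ht j))

/-- The integral of the Gegenbauer generating function against the product weight on the cube. -/
noncomputable def genInt {m : ℕ} (κ : Fin m → ℝ) (μ : ℝ) (a : Fin m → ℝ) (r : ℂ) : ℂ :=
  ∫ t : Fin m → ℝ, genQuad (∑ j, a j * t j) r ^ (-μ : ℂ) *
    ∏ j, (((1 - t j ^ 2) ^ (κ j - 1) : ℝ) : ℂ)
    ∂(Measure.pi fun _ => volume.restrict (Set.Icc (-1) 1))

theorem conj_genInt {m : ℕ} (κ : Fin m → ℝ) (μ : ℝ) {a : Fin m → ℝ} (ha : ∀ j, 0 ≤ a j)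
    (ha1 : ∑ j, a j ≤ 1) {r : ℂ} (hr : ‖r‖ < 1) :
    (starRingEnd ℂ) (genInt κ μ a r) = genInt κ μ a ((starRingEnd ℂ) r) := by
  unfold genInt
  rw [← integral_conj]
  refine integral_congr_ae ?_
  filter_upwards [ae_pi_restrict_Icc (Fin m)] with t ht
  have h := (mem_slitPlane_iff_arg.1 (genQuad_mem_slitPlane (abs_sum_mul_le ha ha1 ht) hr)).1
  have h' := conj_cpow _ (-μ : ℂ) h
  rw [map_mul, map_prod, ← conj_genQuad, h']
  simp only [Complex.conj_ofReal, map_neg]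

theorem exists_norm_genInt_le {m : ℕ} {κ : Fin (m + 1) → ℝ} (hκ : ∀ j, 0 < κ j) {μ : ℝ}
    (hμ : ∑ j, κ j < μ) :
    ∃ C, 0 < C ∧ ∀ a : Fin (m + 1) → ℝ, (∀ j, 0 ≤ a j) → ∑ j, a j ≤ 1 → ∀ r : ℂ, 1 / 4 ≤ ‖r‖ →
      ‖r‖ < 1 → r.im ≠ 0 → ∀ δ : ℝ, 0 < δ →
      (∀ ε : Fin (m + 1) → ℝ, (∀ j, ε j = 1 ∨ ε j = -1) →
        δ ≤ ‖genQuad (∑ j, a j * ε j) r‖) →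
      ‖genInt κ μ a r‖ ≤ C * (δ ^ (-(μ - ∑ j, κ j)) * ∏ j, (δ + a j) ^ (-κ j)) := by
  obtain ⟨C, hC, hmain⟩ := exists_norm_integral_cpow_le hκ hμ
  have hs : 0 < ∑ j, κ j := Finset.sum_pos (fun j _ => hκ j) ⟨0, Finset.mem_univ _⟩
  have hlow : ∀ a : Fin (m + 1) → ℝ, (∀ j, 0 ≤ a j) → ∑ j, a j ≤ 1 → ∀ r : ℂ, 1 / 4 ≤ ‖r‖ →
      ‖r‖ < 1 → r.im < 0 → ∀ δ : ℝ, 0 < δ →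
      (∀ ε : Fin (m + 1) → ℝ, (∀ j, ε j = 1 ∨ ε j = -1) →
        δ ≤ ‖genQuad (∑ j, a j * ε j) r‖) →
      ‖genInt κ μ a r‖ ≤
        4 ^ μ * C * (δ ^ (-(μ - ∑ j, κ j)) * ∏ j, (δ + a j) ^ (-κ j)) := by
    intro a ha ha1 r hr4 hr him δ hδ hε
    have h0 : r ≠ 0 := fun h => by simp [h] at him
    have hcorner : ∀ ε : Fin (m + 1) → ℝ, (∀ j, ε j = 1 ∨ ε j = -1) →
        δ / 2 ≤ ‖(r + r⁻¹) / 2 - ∑ j, (a j * ε j : ℂ)‖ := by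
      intro ε hε'
      have h := hε ε hε'
      rw [genQuad_eq_mul h0, norm_mul, norm_mul, Complex.norm_ofNat] at h
      push_cast at h
      nlinarith [norm_nonneg ((r + r⁻¹) / 2 - ∑ j, (a j * ε j : ℂ))]
    have h := hmain a ha _ (im_add_inv_pos hr him) (δ / 2) (by positivity) hcorner
    have heq : genInt κ μ a r = (2 * r) ^ (-μ : ℂ) * ∫ t : Fin (m + 1) → ℝ,
        ((r + r⁻¹) / 2 - ∑ j, a j * (t j : ℂ)) ^ (-μ : ℂ) *
          ∏ j, (((1 - t j ^ 2) ^ (κ j - 1) : ℝ) : ℂ)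
        ∂(Measure.pi fun _ => volume.restrict (Set.Icc (-1) 1)) := by
      rw [← MeasureTheory.integral_const_mul]
      unfold genInt
      congr 1 with t
      rw [genQuad_cpow_eq_mul hr him, mul_assoc]
      push_cast
      rfl
    have h2r : ‖(2 * r) ^ (-μ : ℂ)‖ ≤ 2 ^ μ := by
      have := norm_cpow_neg_le (hs.trans hμ).le (y := 1 / 2) (X := 2 * r) (by norm_num)
        (by rw [norm_mul, Complex.norm_ofNat]; linarith)
      rwa [one_div, Real.inv_rpow (by norm_num), Real.rpow_neg (by norm_num), inv_inv] at this
    have hδ2 : (δ / 2) ^ (-(μ - ∑ j, κ j)) = 2 ^ (μ - ∑ j, κ j) * δ ^ (-(μ - ∑ j, κ j)) := by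
      rw [Real.div_rpow hδ.le (by norm_num), Real.rpow_neg (by norm_num : (0 : ℝ) ≤ 2),
        div_inv_eq_mul,
        mul_comm]
    have hprod : ∏ j, (δ / 2 + a j) ^ (-κ j) ≤
        2 ^ (∑ j, κ j) * ∏ j, (δ + a j) ^ (-κ j) := by
      rw [Real.rpow_sum_of_pos (by norm_num), ← Finset.prod_mul_distrib]
      refine Finset.prod_le_prod (fun j _ => ?_) fun j _ => ?_
      · have := ha j
        positivity
      · have := ha j
        have h1 : (δ / 2 + a j) ^ (-κ j) ≤ ((δ + a j) / 2) ^ (-κ j) :=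
          Real.rpow_le_rpow_of_nonpos (by positivity) (by linarith) (by linarith [hκ j])
        rwa [Real.div_rpow (by positivity) (by norm_num), Real.rpow_neg (by norm_num : (0 : ℝ) ≤ 2),
          div_inv_eq_mul, mul_comm] at h1
    rw [heq, norm_mul]
    calc _ ≤ 2 ^ μ * (C * ((2 ^ (μ - ∑ j, κ j) * δ ^ (-(μ - ∑ j, κ j))) *
          (2 ^ (∑ j, κ j) * ∏ j, (δ + a j) ^ (-κ j)))) := by
          refine mul_le_mul h2r (h.trans ?_) (norm_nonneg _) (by positivity)
          rw [hδ2]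
          gcongr
      _ = _ := by
          have h4 : (4 : ℝ) ^ μ = 2 ^ μ * (2 ^ (μ - ∑ j, κ j) * 2 ^ (∑ j, κ j)) := by
            rw [← Real.rpow_add (by norm_num), sub_add_cancel,
              ← Real.mul_rpow (by norm_num) (by norm_num)]
            norm_num
          rw [h4]
          ring
  refine ⟨4 ^ μ * C, by positivity, fun a ha ha1 r hr4 hr him δ hδ hε => ?_⟩
  rcases lt_or_gt_of_ne him with h | h
  · exact hlow a ha ha1 r hr4 hr h δ hδ hε
  · rw [← Complex.norm_conj, conj_genInt κ μ ha ha1 hr]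
    refine hlow a ha ha1 _ (by rwa [Complex.norm_conj]) (by rwa [Complex.norm_conj])
      (by simpa using h) δ hδ fun ε hε' => ?_
    rw [← conj_genQuad, Complex.norm_conj]
    exact hε ε hε'

end GeneratingFunction

section CircleEstimates

open Complex

theorem norm_circleMap_sub_sq (R φ θ : ℝ) :
    ‖circleMap 0 R φ - circleMap 0 1 θ‖ ^ 2 = (1 - R) ^ 2 + 4 * R * Real.sin ((φ - θ) / 2) ^ 2 := by
  have h : Real.sin ((φ - θ) / 2) ^ 2 =
      (1 - (Real.cos φ * Real.cos θ + Real.sin φ * Real.sin θ)) / 2 := by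
    rw [← Real.cos_sub, Real.sin_sq_eq_half_sub]
    ring_nf
  rw [Complex.sq_norm, normSq_apply, h]
  simp only [circleMap, zero_add, ofReal_one, one_mul, sub_re, sub_im, re_ofReal_mul,
    im_ofReal_mul, exp_ofReal_mul_I_re, exp_ofReal_mul_I_im]
  linear_combination R ^ 2 * Real.sin_sq_add_cos_sq φ + Real.sin_sq_add_cos_sq θ

theorem genQuad_cos_eq_mul (θ : ℝ) (r : ℂ) :
    genQuad (Real.cos θ) r = (r - circleMap 0 1 θ) * (r - circleMap 0 1 (-θ)) := by
  simp only [genQuad, circleMap, zero_add, ofReal_one, one_mul, ofReal_cos, ofReal_neg]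
  rw [exp_mul_I, exp_mul_I, Complex.cos_neg, Complex.sin_neg]
  linear_combination (-1 : ℂ) * Complex.sin_sq_add_cos_sq (θ : ℂ) +
    Complex.sin θ ^ 2 * Complex.I_sq

section
variable {η : ℝ} (hη : 0 < η) (hη1 : η ≤ 1)
include hη hη1

theorem half_le_one_sub_exp_neg : η / 2 ≤ 1 - Real.exp (-η) := by
  have h1 : 1 + η ≤ Real.exp η := by linarith [Real.add_one_le_exp η]
  have h2 : Real.exp (-η) ≤ (1 + η)⁻¹ := by
    rw [Real.exp_neg]
    exact inv_anti₀ (by linarith) h1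
  have h3 : (1 + η)⁻¹ ≤ 1 - η / 2 := by
    rw [inv_le_iff_one_le_mul₀ (by linarith)]
    nlinarith
  linarith

theorem exp_neg_bounds : 1 / 3 ≤ Real.exp (-η) ∧ Real.exp (-η) < 1 := by
  refine ⟨?_, Real.exp_lt_one_iff.2 (by linarith)⟩
  have h := Real.exp_le_exp.2 hη1
  have h3 : Real.exp 1 ≤ 3 := by linarith [Real.exp_one_lt_d9]
  rw [Real.exp_neg, one_div]
  exact inv_anti₀ (Real.exp_pos _) (h.trans h3)

variable {θ φ : ℝ} (hθ : θ ∈ Set.Icc 0 π) (hφ : φ ∈ Set.Icc 0 π)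
include hθ hφ

theorem add_sq_le_norm_circleMap_sub_sq :
    ((φ - θ) ^ 2 + η ^ 2) / 9 ≤ ‖circleMap 0 (Real.exp (-η)) φ - circleMap 0 1 θ‖ ^ 2 := by
  obtain ⟨hR, -⟩ := exp_neg_bounds hη hη1
  have h2 := half_le_one_sub_exp_neg hη hη1
  rw [norm_circleMap_sub_sq]
  have hu : |φ - θ| ≤ π := abs_le.2 ⟨by linarith [hθ.2, hφ.1], by linarith [hφ.2, hθ.1]⟩
  have hs : 2 / π * (|φ - θ| / 2) ≤ Real.sin (|φ - θ| / 2) :=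
    Real.mul_le_sin (by positivity) (by linarith)
  have hs2 : Real.sin (|φ - θ| / 2) ^ 2 = Real.sin ((φ - θ) / 2) ^ 2 := by
    rcases abs_cases (φ - θ) with h | h
    · rw [h.1]
    · rw [h.1, neg_div, Real.sin_neg, neg_sq]
  have hπ : (1 / 3.3 : ℝ) ≤ 1 / π :=
    one_div_le_one_div_of_le Real.pi_pos (by linarith [Real.pi_lt_d2])
  have h3 : 1 / 3.3 * |φ - θ| ≤ Real.sin (|φ - θ| / 2) := by
    refine le_trans ?_ hs
    rw [show 2 / π * (|φ - θ| / 2) = 1 / π * |φ - θ| by ring]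
    gcongr
  have h4 : (1 / 3.3) ^ 2 * (φ - θ) ^ 2 ≤ Real.sin ((φ - θ) / 2) ^ 2 := by
    rw [← hs2, ← sq_abs (φ - θ), ← mul_pow]
    gcongr
  have h5 : 4 * (1 / 3) * ((1 / 3.3) ^ 2 * (φ - θ) ^ 2) ≤
      4 * Real.exp (-η) * Real.sin ((φ - θ) / 2) ^ 2 := by gcongr
  nlinarith [sq_nonneg (φ - θ)]

theorem add_sin_le_norm_circleMap_sub :
    (Real.sin φ + Real.sin θ + η) / 3 ≤
      ‖circleMap 0 (Real.exp (-η)) φ - circleMap 0 1 (-θ)‖ := by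
  obtain ⟨hR, -⟩ := exp_neg_bounds hη hη1
  have h2 := half_le_one_sub_exp_neg hη hη1
  refine le_of_sq_le_sq ?_ (norm_nonneg _)
  rw [norm_circleMap_sub_sq, sub_neg_eq_add]
  have hsθ := Real.sin_nonneg_of_mem_Icc hθ
  have hsφ := Real.sin_nonneg_of_mem_Icc hφ
  have hs0 : 0 ≤ Real.sin ((φ + θ) / 2) := Real.sin_nonneg_of_nonneg_of_le_pi
    (by linarith [hθ.1, hφ.1]) (by linarith [hθ.2, hφ.2])
  have hs : (Real.sin φ + Real.sin θ) / 2 ≤ Real.sin ((φ + θ) / 2) := by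
    have h1 : Real.sin φ + Real.sin θ =
        2 * Real.sin ((φ + θ) / 2) * Real.cos ((φ - θ) / 2) := by
      rw [Real.sin_add_sin]
    have h3 := Real.cos_le_one ((φ - θ) / 2)
    nlinarith
  have h4 : ((Real.sin φ + Real.sin θ) / 2) ^ 2 ≤ Real.sin ((φ + θ) / 2) ^ 2 := by gcongr
  have h5 : 4 * (1 / 3) * ((Real.sin φ + Real.sin θ) / 2) ^ 2 ≤
      4 * Real.exp (-η) * Real.sin ((φ + θ) / 2) ^ 2 := by gcongr
  nlinarith [sq_nonneg (Real.sin φ + Real.sin θ - η), sq_nonneg (Real.sin φ + Real.sin θ)]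

theorem mul_le_norm_genQuad_sq :
    ((φ - θ) ^ 2 + η ^ 2) * (Real.sin φ + Real.sin θ + η) ^ 2 / 81 ≤
      ‖genQuad (Real.cos θ) (circleMap 0 (Real.exp (-η)) φ)‖ ^ 2 := by
  have h1 := add_sq_le_norm_circleMap_sub_sq hη hη1 hθ hφ
  have h2 := add_sin_le_norm_circleMap_sub hη hη1 hθ hφ
  have hsθ := Real.sin_nonneg_of_mem_Icc hθ
  have hsφ := Real.sin_nonneg_of_mem_Icc hφ
  rw [genQuad_cos_eq_mul, norm_mul, mul_pow]
  calc _ = ((φ - θ) ^ 2 + η ^ 2) / 9 * ((Real.sin φ + Real.sin θ + η) / 3) ^ 2 := by ring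
    _ ≤ _ := by gcongr

end

theorem norm_one_sub_circleMap_sq_le {η : ℝ} (hη : 0 < η) (φ : ℝ) :
    ‖1 - circleMap 0 (Real.exp (-η)) φ ^ 2‖ ≤ 2 * (|Real.sin φ| + η) := by
  have h1 : (1 : ℂ) - circleMap 0 (Real.exp (-η)) φ ^ 2 = ((1 - Real.exp (-η) ^ 2 : ℝ) : ℂ) +
      ((Real.exp (-η) ^ 2 : ℝ) : ℂ) * (-2 * I * (Real.sin φ : ℝ) * cexp (φ * I)) := by
    simp only [circleMap, zero_add]
    push_cast
    rw [exp_mul_I]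
    linear_combination (cexp (-η)) ^ 2 * (-(Complex.sin_sq_add_cos_sq (φ : ℂ)) +
      Complex.sin φ ^ 2 * Complex.I_sq)
  have hR1 : Real.exp (-η) < 1 := Real.exp_lt_one_iff.2 (by linarith)
  have hR0 := Real.exp_pos (-η)
  have h2 : 1 - η ≤ Real.exp (-η) := by linarith [Real.add_one_le_exp (-η)]
  rw [h1]
  refine (norm_add_le _ _).trans ?_
  rw [norm_mul, norm_mul, norm_mul, norm_mul, norm_exp_ofReal_mul_I, norm_real, norm_real,
    norm_real, norm_I, norm_neg, Complex.norm_ofNat, Real.norm_eq_abs, Real.norm_eq_abs,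
    Real.norm_eq_abs, abs_of_nonneg (by nlinarith), abs_of_nonneg (by positivity)]
  have h3 : Real.exp (-η) ^ 2 * |Real.sin φ| ≤ |Real.sin φ| :=
    mul_le_of_le_one_left (abs_nonneg _) (by nlinarith)
  nlinarith

theorem circleMap_two_pi_sub (R φ : ℝ) :
    circleMap 0 R (2 * π - φ) = (starRingEnd ℂ) (circleMap 0 R φ) := by
  have h : cexp ((2 * π - φ) * I) = cexp (-(φ * I)) := by
    rw [sub_mul, Complex.exp_sub, Complex.exp_two_pi_mul_I, Complex.exp_neg, one_div]
  simp [circleMap, h, ← Complex.exp_conj]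

theorem exists_mul_le_norm_genQuad_sq {η : ℝ} (hη : 0 < η) (hη1 : η ≤ 1) {z : ℝ} (hz : |z| ≤ 1)
    {φ : ℝ} (hφ : φ ∈ Set.Icc 0 (2 * π)) :
    ∃ ψ, (ψ = φ ∨ ψ = 2 * π - φ) ∧
      ((ψ - Real.arccos z) ^ 2 + η ^ 2) * (|Real.sin φ| + √(1 - z ^ 2) + η) ^ 2 / 81 ≤
        ‖genQuad z (circleMap 0 (Real.exp (-η)) φ)‖ ^ 2 := by
  have hθ : Real.arccos z ∈ Set.Icc 0 π := ⟨Real.arccos_nonneg z, Real.arccos_le_pi z⟩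
  have hcos := Real.cos_arccos (abs_le.1 hz).1 (abs_le.1 hz).2
  rcases le_total φ π with h | h
  · have hφ' : φ ∈ Set.Icc 0 π := ⟨hφ.1, h⟩
    refine ⟨φ, Or.inl rfl, ?_⟩
    rw [abs_of_nonneg (Real.sin_nonneg_of_mem_Icc hφ'), ← Real.sin_arccos]
    exact (mul_le_norm_genQuad_sq hη hη1 hθ hφ').trans_eq (by rw [hcos])
  · have hφ' : 2 * π - φ ∈ Set.Icc 0 π := ⟨by linarith [hφ.2], by linarith⟩
    refine ⟨2 * π - φ, Or.inr rfl, ?_⟩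
    have hs : |Real.sin φ| = Real.sin (2 * π - φ) := by
      have := Real.sin_nonneg_of_mem_Icc hφ'
      rw [Real.sin_two_pi_sub] at this ⊢
      exact abs_of_nonpos (by linarith)
    rw [hs, ← Real.sin_arccos, ← Complex.norm_conj, conj_genQuad, ← circleMap_two_pi_sub]
    exact (mul_le_norm_genQuad_sq hη hη1 hθ hφ').trans_eq (by rw [hcos])

/-- The Poisson-type kernel `η / (u² + η²)`. -/
noncomputable def peak (η u : ℝ) : ℝ := η / (u ^ 2 + η ^ 2)

theorem continuous_peak {η : ℝ} (hη : 0 < η) : Continuous (peak η) := by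
  unfold peak
  exact continuous_const.div (by fun_prop) fun u => by positivity

theorem integral_peak_le {η : ℝ} (hη : 0 < η) (a b : ℝ) : ∫ u in a..b, peak η u ≤ π := by
  have h : ∀ u, peak η u = η * (η ^ 2 + u ^ 2)⁻¹ := fun u => by
    rw [peak, div_eq_mul_inv, add_comm]
  simp_rw [h]
  rw [intervalIntegral.integral_const_mul, integral_inv_sq_add_sq hη.ne',
    mul_inv_cancel_left₀ hη.ne']
  linarith [Real.arctan_lt_pi_div_two (b / η), Real.neg_pi_div_two_lt_arctan (a / η)]

theorem integral_peak_add_peak_le {η : ℝ} (hη : 0 < η) (θ : ℝ) :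
    ∫ φ in (0 : ℝ)..2 * π, (peak η (φ - θ) + peak η (2 * π - φ - θ)) ≤ 2 * π := by
  have hc := continuous_peak hη
  have h1 : IntervalIntegrable (fun φ => peak η (φ - θ)) volume 0 (2 * π) :=
    Continuous.intervalIntegrable (by fun_prop) _ _
  have h2 : IntervalIntegrable (fun φ => peak η (2 * π - θ - φ)) volume 0 (2 * π) :=
    Continuous.intervalIntegrable (by fun_prop) _ _
  simp_rw [sub_right_comm (2 * π) _ θ]
  rw [intervalIntegral.integral_add h1 h2, intervalIntegral.integral_comp_sub_right (peak η),
    intervalIntegral.integral_comp_sub_left (peak η)]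
  linarith [integral_peak_le hη (0 - θ) (2 * π - θ),
    integral_peak_le hη (2 * π - θ - 2 * π) (2 * π - θ - 0)]

theorem norm_projKer_le {l : ℝ} (hl : 0 < l) {n : ℕ} (hn : 1 ≤ n) (φ : ℝ) :
    ‖projKer l (2 * n) (circleMap 0 (Real.exp (-(n : ℝ)⁻¹)) φ)‖ ≤
      6 * (l * (l + 1)) * Real.exp 3 * ((n : ℝ)⁻¹ * (|Real.sin φ| + (n : ℝ)⁻¹) ^ 2) := by
  have hn1 : (1 : ℝ) ≤ n := by exact_mod_cast hn
  have hn0 : (0 : ℝ) < n := by linarith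
  set η := (n : ℝ)⁻¹ with hη
  have hη0 : 0 < η := by positivity
  have hη1 : η ≤ 1 := inv_le_one_of_one_le₀ hn1
  set r := circleMap 0 (Real.exp (-η)) φ with hr
  set Y := |Real.sin φ| + η with hY
  have hηY : η ≤ Y := by linarith [abs_nonneg (Real.sin φ)]
  have hY0 : 0 < Y := by linarith
  have h1 : ‖1 - r ^ 2‖ ≤ 2 * Y := norm_one_sub_circleMap_sq_le hη0 φ
  have hrn : ‖r‖ = Real.exp (-η) := by rw [hr, norm_circleMap_zero, abs_of_pos (Real.exp_pos _)]
  have hr1 : ‖r‖ ≤ 1 := by rw [hrn]; exact Real.exp_le_one_iff.2 (by linarith)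
  have hpow : ‖r ^ (-((2 * n : ℕ) : ℤ) - 1)‖ ≤ Real.exp 3 := by
    rw [norm_zpow, hrn, ← Real.rpow_intCast, ← Real.exp_mul]
    refine Real.exp_le_exp.2 ?_
    push_cast
    have : n * η = 1 := mul_inv_cancel₀ hn0.ne'
    nlinarith
  have hA : ‖(l * (l + 1) / ((2 * n : ℕ) + l + 1) : ℂ)‖ ≤ l * (l + 1) * η := by
    have : (l * (l + 1) / ((2 * n : ℕ) + l + 1) : ℂ) =
        ((l * (l + 1) / (2 * n + l + 1) : ℝ) : ℂ) := by push_cast; ring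
    rw [this, norm_real, Real.norm_eq_abs, abs_of_nonneg (by positivity), hη, ← div_eq_mul_inv]
    exact div_le_div_of_nonneg_left (by positivity) hn0 (by linarith)
  have hB : ‖(2 * l * (l + 1) / (((2 * n : ℕ) + l + 1) * ((2 * n : ℕ) + l - 1)) : ℂ)‖ ≤
      l * (l + 1) * η ^ 2 := by
    have : (2 * l * (l + 1) / (((2 * n : ℕ) + l + 1) * ((2 * n : ℕ) + l - 1)) : ℂ) =
        ((2 * (l * (l + 1)) / ((2 * n + l + 1) * (2 * n + l - 1)) : ℝ) : ℂ) := by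
      push_cast; ring
    have h2 : 2 * (n * n : ℝ) ≤ (2 * n + l + 1) * (2 * n + l - 1) := by nlinarith
    rw [this, norm_real, Real.norm_eq_abs,
      abs_of_nonneg (div_nonneg (by positivity) ((by positivity : (0 : ℝ) ≤ 2 * (n * n)).trans h2))]
    calc _ ≤ 2 * (l * (l + 1)) / (2 * (n * n)) :=
          div_le_div_of_nonneg_left (by positivity) (by positivity) h2
      _ = _ := by rw [hη]; field_simp
  rw [projKer, norm_mul]
  calc _ ≤ (l * (l + 1) * η * (2 * Y) ^ 2 + l * (l + 1) * η ^ 2 * (1 * (2 * Y))) * Real.exp 3 := by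
        refine mul_le_mul ((norm_sub_le _ _).trans (add_le_add ?_ ?_)) hpow (norm_nonneg _)
          (by positivity)
        · rw [norm_mul, norm_pow]
          gcongr
        · rw [norm_mul, norm_mul, norm_pow]
          gcongr
          exact pow_le_one₀ (norm_nonneg _) hr1
    _ ≤ _ := by
        have : η ^ 2 * Y ≤ η * Y ^ 2 := by nlinarith [mul_pos hη0 hY0]
        have h3 : 0 < l * (l + 1) * Real.exp 3 := by positivity
        nlinarith

theorem norm_projKer_le_norm_genQuad_sq {l : ℝ} (hl : 0 < l) {n : ℕ} (hn : 1 ≤ n) {z : ℝ}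
    (hz : |z| ≤ 1) {φ : ℝ} (hφ : φ ∈ Set.Icc 0 (2 * π)) :
    ‖projKer l (2 * n) (circleMap 0 (Real.exp (-(n : ℝ)⁻¹)) φ)‖ ≤
      486 * (l * (l + 1)) * Real.exp 3 *
        (‖genQuad z (circleMap 0 (Real.exp (-(n : ℝ)⁻¹)) φ)‖ ^ 2 *
          (peak (n : ℝ)⁻¹ (φ - Real.arccos z) + peak (n : ℝ)⁻¹ (2 * π - φ - Real.arccos z))) := by
  have hn1 : (1 : ℝ) ≤ n := by exact_mod_cast hn
  refine (norm_projKer_le hl hn φ).trans ?_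
  set η := (n : ℝ)⁻¹ with hη
  have hη0 : 0 < η := inv_pos.2 (by linarith)
  have hη1 : η ≤ 1 := inv_le_one_of_one_le₀ hn1
  obtain ⟨ψ, hψ, hle⟩ := exists_mul_le_norm_genQuad_sq hη0 hη1 hz hφ
  set Q := ‖genQuad z (circleMap 0 (Real.exp (-η)) φ)‖ ^ 2
  have hpk : ∀ u, 0 ≤ peak η u := fun u => div_nonneg hη0.le (by positivity)
  have hpeak : peak η (ψ - Real.arccos z) ≤
      peak η (φ - Real.arccos z) + peak η (2 * π - φ - Real.arccos z) := by
    rcases hψ with rfl | rfl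
    · linarith [hpk (2 * π - ψ - Real.arccos z)]
    · linarith [hpk (φ - Real.arccos z)]
  have hX : 0 < (ψ - Real.arccos z) ^ 2 + η ^ 2 := by positivity
  have hkey : η * (|Real.sin φ| + η) ^ 2 ≤ 81 * (Q * peak η (ψ - Real.arccos z)) := by
    calc _ ≤ η * (|Real.sin φ| + √(1 - z ^ 2) + η) ^ 2 := by
          have := Real.sqrt_nonneg (1 - z ^ 2)
          gcongr
          linarith
      _ = 81 * (((ψ - Real.arccos z) ^ 2 + η ^ 2) * (|Real.sin φ| + √(1 - z ^ 2) + η) ^ 2 / 81 *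
            peak η (ψ - Real.arccos z)) := by
          unfold peak
          field_simp
      _ ≤ _ := by
          have := hpk (ψ - Real.arccos z)
          gcongr
  calc _ ≤ 6 * (l * (l + 1)) * Real.exp 3 * (81 * (Q * (peak η (φ - Real.arccos z) +
        peak η (2 * π - φ - Real.arccos z)))) := by
        refine mul_le_mul_of_nonneg_left (hkey.trans ?_) (by positivity)
        gcongr
    _ = _ := by ring

theorem le_norm_genQuad {η : ℝ} (hη : 0 < η) (hη1 : η ≤ 1) {z : ℝ} (hz : |z| ≤ 1) {s : ℝ}
    (hs : 0 ≤ s) (hsz : s ^ 2 ≤ 1 - z ^ 2) {φ : ℝ} (hφ : φ ∈ Set.Icc 0 (2 * π)) :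
    η * (η + s) / 9 ≤ ‖genQuad z (circleMap 0 (Real.exp (-η)) φ)‖ := by
  obtain ⟨ψ, -, hle⟩ := exists_mul_le_norm_genQuad_sq hη hη1 hz hφ
  have h1 : s ≤ √(1 - z ^ 2) := Real.le_sqrt_of_sq_le hsz
  refine le_of_sq_le_sq (le_trans ?_ hle) (norm_nonneg _)
  calc (η * (η + s) / 9) ^ 2 = (0 + η ^ 2) * (0 + s + η) ^ 2 / 81 := by ring
    _ ≤ _ := by gcongr <;> positivity

theorem exists_norm_circleIntegral_genInt_le {m : ℕ} {κ : Fin (m + 1) → ℝ} (hκ : ∀ j, 0 < κ j)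
    {l : ℝ} (hl : ∑ j, κ j ≤ l) :
    ∃ C, 0 < C ∧ ∀ a : Fin (m + 1) → ℝ, (∀ j, 0 ≤ a j) → ∑ j, a j ≤ 1 → ∀ n : ℕ, 1 ≤ n →
      ∀ ρ : ℝ, 0 ≤ ρ → ρ ^ 2 ≤ 2 - 2 * ∑ j, a j →
      ‖∮ r in C(0, Real.exp (-(n : ℝ)⁻¹)), genInt κ (l + 2) a r * projKer l (2 * n) r‖ ≤
        C * (((n : ℝ)⁻¹ * ((n : ℝ)⁻¹ + ρ)) ^ (-(l - ∑ j, κ j)) *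
          ∏ j, ((n : ℝ)⁻¹ * ((n : ℝ)⁻¹ + ρ) + a j) ^ (-κ j)) := by
  have hs0 : 0 < ∑ j, κ j := Finset.sum_pos (fun j _ => hκ j) ⟨0, Finset.mem_univ _⟩
  have hl0 : 0 < l := hs0.trans_le hl
  obtain ⟨C, hC, hmain⟩ := exists_norm_genInt_le hκ (μ := l + 2) (by linarith)
  set K := 486 * (l * (l + 1)) * Real.exp 3 with hK
  set M : ℝ := ((Fintype.card (Fin (m + 1) → ℤˣ) : ℕ) : ℝ) with hM
  have hM0 : 0 < M := by
    rw [hM]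
    exact_mod_cast Fintype.card_pos
  refine ⟨C * 18 ^ l * K * (M * (2 * π)), by positivity, fun a ha ha1 n hn ρ hρ hρa => ?_⟩
  have hn1 : (1 : ℝ) ≤ n := by exact_mod_cast hn
  have hprojle := fun z hz φ hφ => norm_projKer_le_norm_genQuad_sq hl0 hn (z := z) hz (φ := φ) hφ
  set η := (n : ℝ)⁻¹ with hη
  have hη0 : 0 < η := inv_pos.2 (by linarith)
  have hη1 : η ≤ 1 := inv_le_one_of_one_le₀ hn1
  set R := Real.exp (-η) with hR
  obtain ⟨hR3, hR1⟩ := exp_neg_bounds hη0 hη1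
  set z : (Fin (m + 1) → ℤˣ) → ℝ := fun u => ∑ j, a j * ((u j : ℤ) : ℝ) with hz
  have hz1 : ∀ u, |z u| ≤ ∑ j, a j := fun u => by
    refine (Finset.abs_sum_le_sum_abs _ _).trans (Finset.sum_le_sum fun j _ => ?_)
    rcases Int.units_eq_one_or (u j) with h | h <;> simp [h, abs_of_nonneg (ha j)]
  have hS0 : 0 ≤ ∑ j, a j := Finset.sum_nonneg fun j _ => ha j
  set D := η * (η + ρ) with hD
  have hD0 : 0 < D := by positivity
  set A := D ^ (-(l - ∑ j, κ j)) * ∏ j, (D + a j) ^ (-κ j) with hA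
  have hA0 : 0 < A := mul_pos (by positivity)
    (Finset.prod_pos fun j _ => Real.rpow_pos_of_pos (by linarith [ha j]) _)
  set G : (Fin (m + 1) → ℤˣ) → ℝ → ℝ := fun u φ =>
    peak η (φ - Real.arccos (z u)) + peak η (2 * π - φ - Real.arccos (z u)) with hG
  have hG0 : ∀ u φ, 0 ≤ G u φ := fun u φ =>
    add_nonneg (div_nonneg hη0.le (by positivity)) (div_nonneg hη0.le (by positivity))
  have hGc : ∀ u, Continuous (G u) := fun u =>
    ((continuous_peak hη0).comp (by fun_prop)).add ((continuous_peak hη0).comp (by fun_prop))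
  have hpt : ∀ φ ∈ Set.Icc 0 (2 * π), Real.sin φ ≠ 0 →
      ‖deriv (circleMap 0 R) φ • (genInt κ (l + 2) a (circleMap 0 R φ) *
        projKer l (2 * n) (circleMap 0 R φ))‖ ≤ C * 18 ^ l * K * A * ∑ u, G u φ := by
    intro φ hφ hsin
    set r := circleMap 0 R φ with hr
    have hrn : ‖r‖ = R := by rw [hr, norm_circleMap_zero, abs_of_pos (Real.exp_pos _)]
    have him : r.im ≠ 0 := by
      rw [hr, circleMap, zero_add, im_ofReal_mul, exp_ofReal_mul_I_im]
      exact mul_ne_zero (Real.exp_pos _).ne' hsin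
    obtain ⟨u, -, hu⟩ := Finset.exists_min_image Finset.univ (fun u => ‖genQuad (z u) r‖)
      Finset.univ_nonempty
    set δ := ‖genQuad (z u) r‖ with hδ
    have hDδ : D / 18 ≤ δ := by
      have h1 : (ρ / 2) ^ 2 ≤ 1 - z u ^ 2 := by
        have : z u ^ 2 ≤ (∑ j, a j) ^ 2 := sq_le_sq' (abs_le.1 (hz1 u)).1 (abs_le.1 (hz1 u)).2
        nlinarith
      have h2 := le_norm_genQuad hη0 hη1 ((hz1 u).trans ha1) (by positivity) h1 hφ
      refine le_trans ?_ h2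
      rw [hD]
      nlinarith
    have hδ0 : 0 < δ := lt_of_lt_of_le (by positivity) hDδ
    have hint := hmain a ha ha1 r (by rw [hrn]; linarith) (by rw [hrn]; exact hR1) him δ hδ0
      fun ε hε => by
        have hzε : z (fun j => if ε j = 1 then 1 else -1) = ∑ j, a j * ε j := by
          refine Finset.sum_congr rfl fun j _ => ?_
          rcases hε j with h | h
          · simp [h]
          · norm_num [h]
        rw [← hzε]
        exact hu _ (Finset.mem_univ _)
    have hproj := hprojle (z u) ((hz1 u).trans ha1) φ hφ
    have hδA : δ ^ (-(l + 2 - ∑ j, κ j)) * ∏ j, (δ + a j) ^ (-κ j) ≤ δ⁻¹ ^ 2 * (18 ^ l * A) := by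
      have e1 : δ ^ (-(l + 2 - ∑ j, κ j)) = δ⁻¹ ^ 2 * δ ^ (-(l - ∑ j, κ j)) := by
        rw [inv_pow, ← Real.rpow_natCast, ← Real.rpow_neg hδ0.le, ← Real.rpow_add hδ0]
        congr 1
        push_cast
        ring
      have e2 : δ ^ (-(l - ∑ j, κ j)) ≤ 18 ^ (l - ∑ j, κ j) * D ^ (-(l - ∑ j, κ j)) := by
        have := Real.rpow_le_rpow_of_nonpos (by positivity) hDδ
          (show -(l - ∑ j, κ j) ≤ 0 by linarith)
        rwa [Real.div_rpow hD0.le (by norm_num), Real.rpow_neg (by norm_num : (0 : ℝ) ≤ 18),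
          div_inv_eq_mul, mul_comm] at this
      have e3 : ∏ j, (δ + a j) ^ (-κ j) ≤ 18 ^ (∑ j, κ j) * ∏ j, (D + a j) ^ (-κ j) := by
        rw [Real.rpow_sum_of_pos (by norm_num), ← Finset.prod_mul_distrib]
        refine Finset.prod_le_prod (fun j _ => ?_) fun j _ => ?_
        · have := ha j
          positivity
        · have := ha j
          have h1 : (δ + a j) ^ (-κ j) ≤ ((D + a j) / 18) ^ (-κ j) :=
            Real.rpow_le_rpow_of_nonpos (by positivity) (by linarith) (by linarith [hκ j])
          rwa [Real.div_rpow (by positivity) (by norm_num),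
            Real.rpow_neg (by norm_num : (0 : ℝ) ≤ 18), div_inv_eq_mul, mul_comm] at h1
      have e4 : (18 : ℝ) ^ l = 18 ^ (l - ∑ j, κ j) * 18 ^ (∑ j, κ j) := by
        rw [← Real.rpow_add (by norm_num), sub_add_cancel]
      have e5 : 0 ≤ ∏ j, (δ + a j) ^ (-κ j) := Finset.prod_nonneg fun j _ => by
        have := ha j
        positivity
      rw [e1, e4, mul_assoc]
      refine mul_le_mul_of_nonneg_left ?_ (by positivity)
      exact (mul_le_mul e2 e3 e5 (by positivity)).trans_eq (by rw [hA]; ring)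
    have hd1 : ‖deriv (circleMap 0 R) φ‖ ≤ 1 := by
      rw [deriv_circleMap, norm_mul, norm_I, mul_one, ← hr, hrn]
      exact hR1.le
    rw [norm_smul, norm_mul]
    calc _ ≤ 1 * ((C * (δ⁻¹ ^ 2 * (18 ^ l * A))) * (K * (δ ^ 2 * G u φ))) := by
          have := hG0 u φ
          refine mul_le_mul hd1 (mul_le_mul (hint.trans ?_) hproj (norm_nonneg _) (by positivity))
            (by positivity) zero_le_one
          gcongr
      _ = C * 18 ^ l * K * A * G u φ := by
          field_simp
      _ ≤ _ := by
          refine mul_le_mul_of_nonneg_left ?_ (by positivity)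
          exact Finset.single_le_sum (f := fun u => G u φ) (fun u _ => hG0 u φ) (Finset.mem_univ u)
  have hGint : ∀ u, ∫ φ in (0 : ℝ)..2 * π, G u φ ≤ 2 * π := fun u =>
    integral_peak_add_peak_le hη0 _
  have hsin : ∀ᵐ φ : ℝ, Real.sin φ ≠ 0 := by
    rw [ae_iff]
    simp only [ne_eq, not_not]
    refine Set.Countable.measure_zero ?_ _
    have : {φ : ℝ | Real.sin φ = 0} ⊆ Set.range fun k : ℤ => (k : ℝ) * π := fun φ hφ => by
      obtain ⟨k, hk⟩ := Real.sin_eq_zero_iff.1 hφ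
      exact ⟨k, hk⟩
    exact (Set.countable_range _).mono this
  have hcont : Continuous fun φ => C * 18 ^ l * K * A * ∑ u, G u φ :=
    continuous_const.mul (continuous_finsetSum _ fun u _ => hGc u)
  rw [circleIntegral]
  refine (intervalIntegral.norm_integral_le_of_norm_le (by positivity) ?_
    (hcont.intervalIntegrable _ _)).trans ?_
  · filter_upwards [hsin] with φ h hφ
    exact hpt φ ⟨hφ.1.le, hφ.2⟩ h
  · rw [intervalIntegral.integral_const_mul,
      intervalIntegral.integral_finsetSum fun u _ => (hGc u).intervalIntegrable _ _]
    have : ∑ u, ∫ φ in (0 : ℝ)..2 * π, G u φ ≤ M * (2 * π) :=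
      (Finset.sum_le_sum fun u _ => hGint u).trans_eq (by simp [hM])
    calc _ ≤ C * 18 ^ l * K * A * (M * (2 * π)) := by gcongr
      _ = _ := by ring

end CircleEstimates

section Assembly

open Complex

theorem pi_restrict_Icc_eq (m : ℕ) :
    (Measure.pi fun _ : Fin m => volume.restrict (Set.Icc (-1 : ℝ) 1)) =
      volume.restrict (cube m) := by
  rw [← Measure.restrict_pi_pi, cube, volume_pi]

theorem isCompact_cube (m : ℕ) : IsCompact (cube m) := isCompact_univ_pi fun _ => isCompact_Icc

theorem measurableSet_cube (m : ℕ) : MeasurableSet (cube m) :=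
  MeasurableSet.univ_pi fun _ => measurableSet_Icc

theorem integrable_wcube {m : ℕ} {κ : Fin m → ℝ} (hκ : ∀ j, 0 < κ j) :
    Integrable (wcube κ) (volume.restrict (cube m)) := by
  rw [← pi_restrict_Icc_eq]
  exact Integrable.fintype_prod fun j => integrable_one_sub_sq_rpow (hκ j)

theorem continuous_projKer_circleMap (l : ℝ) (N : ℕ) {R : ℝ} (hR : 0 < R) :
    Continuous fun φ => projKer l N (circleMap 0 R φ) := by
  have hc := continuous_circleMap 0 R
  unfold projKer
  refine Continuous.mul (by fun_prop) (hc.zpow₀ _ fun φ => Or.inl ?_)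
  rw [← norm_pos_iff, norm_circleMap_zero]
  exact abs_pos.2 hR.ne'

theorem continuousOn_genQuad_cpow_circleMap {m : ℕ} {a : Fin m → ℝ} (ha : ∀ j, 0 ≤ a j)
    (ha1 : ∑ j, a j ≤ 1) {R : ℝ} (hR0 : 0 < R) (hR : R < 1) (c : ℂ) :
    ContinuousOn (fun p : (Fin m → ℝ) × ℝ => genQuad (∑ j, a j * p.1 j) (circleMap 0 R p.2) ^ c)
      (cube m ×ˢ Set.univ) := by
  have hc : Continuous fun p : (Fin m → ℝ) × ℝ =>
      genQuad (∑ j, a j * p.1 j) (circleMap 0 R p.2) := by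
    have h : Continuous fun p : (Fin m → ℝ) × ℝ => circleMap 0 R p.2 :=
      (continuous_circleMap 0 R).comp continuous_snd
    unfold genQuad
    fun_prop
  refine hc.continuousOn.cpow_const fun p hp => ?_
  refine genQuad_mem_slitPlane (abs_sum_mul_le ha ha1 fun j => hp.1 j (Set.mem_univ j)) ?_
  rwa [norm_circleMap_zero, abs_of_pos hR0]

theorem integral_gegen_eq_circleIntegral {m : ℕ} {κ : Fin m → ℝ} (hκ : ∀ j, 0 < κ j)
    {a : Fin m → ℝ} (ha : ∀ j, 0 ≤ a j) (ha1 : ∑ j, a j ≤ 1) {l : ℝ} (hl : 0 < l) {N : ℕ}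
    (hN : 1 ≤ N) {R : ℝ} (hR0 : 0 < R) (hR : R < 1) :
    ((∫ t in cube m, ((N + l) * (gegen l N).eval (∑ j, a j * t j)) * wcube κ t : ℝ) : ℂ) =
      (2 * π * I)⁻¹ * ∮ r in C(0, R), genInt κ (l + 2) a r * projKer l N r := by
  set G : (Fin m → ℝ) → ℝ → ℂ := fun t φ => deriv (circleMap 0 R) φ *
    (genQuad (∑ j, a j * t j) (circleMap 0 R φ) ^ (-((l + 2 : ℝ) : ℂ)) *
      projKer l N (circleMap 0 R φ)) with hG
  have hGc : ContinuousOn (Function.uncurry G) (cube m ×ˢ Set.univ) := by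
    have hd : Continuous (deriv (circleMap 0 R)) := by
      have : deriv (circleMap 0 R) = fun φ => circleMap 0 R φ * I :=
        funext fun φ => deriv_circleMap 0 R φ
      rw [this]
      exact (continuous_circleMap 0 R).mul continuous_const
    exact (hd.comp continuous_snd).continuousOn.mul
      ((continuousOn_genQuad_cpow_circleMap ha ha1 hR0 hR _).mul
        ((continuous_projKer_circleMap l N hR0).comp continuous_snd).continuousOn)
  have hint : Integrable (Function.uncurry fun t φ => G t φ * (wcube κ t : ℂ))
      ((volume.restrict (cube m)).prod (volume.restrict (Set.Ioc 0 (2 * π)))) := by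
    have hsub : cube m ×ˢ Set.Ioc 0 (2 * π) ⊆ cube m ×ˢ Set.Icc 0 (2 * π) :=
      Set.prod_mono le_rfl Set.Ioc_subset_Icc_self
    obtain ⟨C, hC⟩ := ((isCompact_cube m).prod
      (isCompact_Icc (a := 0) (b := 2 * π))).exists_bound_of_continuousOn
      (hGc.mono (Set.prod_mono le_rfl (Set.subset_univ _)))
    have hms := (measurableSet_cube m).prod (measurableSet_Ioc (a := 0) (b := 2 * π))
    have hw : Integrable (fun t => (wcube κ t : ℂ)) (volume.restrict (cube m)) :=
      (integrable_wcube hκ).ofReal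
    refine (hw.comp_fst _).bdd_mul (c := C) ?_ ?_
    · rw [Measure.prod_restrict]
      exact (hGc.mono (Set.prod_mono le_rfl (Set.subset_univ _))).aestronglyMeasurable hms
    · rw [Measure.prod_restrict, ae_restrict_iff' hms]
      exact Filter.Eventually.of_forall fun p hp => hC p (hsub hp)
  have hgen : ∀ φ, ∫ t in cube m, G t φ * (wcube κ t : ℂ) = deriv (circleMap 0 R) φ •
      (genInt κ (l + 2) a (circleMap 0 R φ) * projKer l N (circleMap 0 R φ)) := by
    intro φ
    rw [genInt, pi_restrict_Icc_eq, smul_eq_mul, ← MeasureTheory.integral_mul_const,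
      ← MeasureTheory.integral_const_mul]
    congr 1 with t
    simp only [hG, wcube, ofReal_prod]
    ring
  refine (integral_complex_ofReal).symm.trans ?_
  calc _ = ∫ t in cube m, (2 * π * I)⁻¹ * ∫ φ in Set.Ioc 0 (2 * π), G t φ * (wcube κ t : ℂ) := by
        refine setIntegral_congr_fun (measurableSet_cube m) fun t ht => ?_
        have hz := abs_sum_mul_le ha ha1 fun j => ht j (Set.mem_univ j)
        have h := gegen_eq_circleIntegral hz hR0 hR hl hN
        rw [circleIntegral, intervalIntegral.integral_of_le (by positivity)] at h
        simp only [smul_eq_mul] at h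
        rw [MeasureTheory.integral_mul_const, ofReal_mul, ← mul_assoc, ← h]
    _ = _ := by
        rw [MeasureTheory.integral_const_mul, integral_integral_swap hint, circleIntegral,
          intervalIntegral.integral_of_le (by positivity)]
        simp_rw [hgen]

theorem xext_nonneg {d : ℕ} {x : Fin d → ℝ} (hx : x ∈ simplexT d) (j : Fin (d + 1)) :
    0 ≤ xext d x j := by
  unfold xext
  split_ifs with h
  · exact hx.1 _
  · linarith [hx.2]

theorem sum_xext (d : ℕ) (x : Fin d → ℝ) : ∑ j, xext d x j = 1 := by
  rw [Fin.sum_univ_castSucc]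
  simp [xext]

theorem distXi_sq {d : ℕ} {x y : Fin d → ℝ} (hx : x ∈ simplexT d) (hy : y ∈ simplexT d) :
    distXi d x y ^ 2 = 2 - 2 * ∑ j, √(xext d x j * xext d y j) := by
  rw [distXi, Real.sq_sqrt (Finset.sum_nonneg fun j _ => sq_nonneg _)]
  have h : ∀ j, (√(xext d x j) - √(xext d y j)) ^ 2 =
      xext d x j + xext d y j - 2 * √(xext d x j * xext d y j) := fun j => by
    rw [Real.sqrt_mul (xext_nonneg hx j), sub_sq, Real.sq_sqrt (xext_nonneg hx j),
      Real.sq_sqrt (xext_nonneg hy j)]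
    ring
  simp_rw [h]
  rw [Finset.sum_sub_distrib, Finset.sum_add_distrib, sum_xext, sum_xext, ← Finset.mul_sum]
  ring

end Assembly

/-- projection kernel estimate on the simplex. -/
theorem projection_kernel_estimate_simplex (d : ℕ) (hd : 1 ≤ d) (κ : Fin (d + 1) → ℝ)
    (hκ : ∀ i, 0 < κ i) (q : ℕ → Polynomial ℝ)
    (hqdeg : ∀ k, (q k).degree = k) (hqlead : ∀ k, 0 < (q k).leadingCoeff)
    (hqorth : ∀ j k, (∫ t in (-1 : ℝ)..1,
        (q j).eval t * (q k).eval t * wJac ((∑ i, κ i) + ((d : ℝ) - 2) / 2) (-(1 / 2)) t) =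
      if j = k then 1 else 0) :
    ∃ c : ℝ, 0 < c ∧ ∀ n : ℕ, 1 ≤ n → ∀ x ∈ simplexT d, ∀ y ∈ simplexT d,
      |simpP d κ q n x y| ≤
        c * (n : ℝ) ^ (((d : ℝ) - 1) / 2) *
          (distXi d x y + (n : ℝ)⁻¹) ^ (-(((d : ℝ) - 1) / 2)) *
          ∏ j, (Real.sqrt (xext d x j * xext d y j) + (n : ℝ)⁻¹ * distXi d x y +
            ((n : ℝ) ^ 2)⁻¹) ^ (-κ j) := by
  have hd1 : (1 : ℝ) ≤ d := by exact_mod_cast hd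
  have hs : 0 < ∑ i, κ i := Finset.sum_pos (fun i _ => hκ i) ⟨0, Finset.mem_univ _⟩
  set l := (∑ i, κ i) + ((d : ℝ) - 1) / 2 with hl
  have hl0 : 0 < l := by linarith
  have hls : l - ∑ i, κ i = ((d : ℝ) - 1) / 2 := by rw [hl]; ring
  rw [show (∑ i, κ i) + ((d : ℝ) - 2) / 2 = l - 1 / 2 by rw [hl]; ring] at hqorth
  obtain ⟨C, hC, hmain⟩ := exists_norm_circleIntegral_genInt_le hκ (l := l) (by linarith)
  set A := (2 ^ l * (l * ultraInt l hl0 1))⁻¹ with hA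
  set B := |(∫ t in cube (d + 1), wcube κ t)⁻¹ * A| * ‖(2 * π * Complex.I)⁻¹‖ with hB
  have hB0 : 0 ≤ B := by positivity
  refine ⟨B * C + 1, by positivity, fun n hn x hx y hy => ?_⟩
  have hn0 : (0 : ℝ) < n := by exact_mod_cast hn
  set a : Fin (d + 1) → ℝ := fun j => √(xext d x j * xext d y j) with ha
  set ρ := distXi d x y with hρ
  have hρ0 : 0 ≤ ρ := Real.sqrt_nonneg _
  have hρa : ρ ^ 2 = 2 - 2 * ∑ j, a j := distXi_sq hx hy
  have ha0 : ∀ j, 0 ≤ a j := fun j => Real.sqrt_nonneg _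
  have ha1 : ∑ j, a j ≤ 1 := by nlinarith [sq_nonneg ρ]
  have hR1 : Real.exp (-(n : ℝ)⁻¹) < 1 := Real.exp_lt_one_iff.2 (neg_lt_zero.2 (inv_pos.2 hn0))
  have hint := integral_gegen_eq_circleIntegral hκ ha0 ha1 hl0 (N := 2 * n) (by omega)
    (Real.exp_pos _) hR1
  have hP : simpP d κ q n x y = (∫ t in cube (d + 1), wcube κ t)⁻¹ * A *
      ∫ t in cube (d + 1), (((2 * n : ℕ) + l) * (gegen l (2 * n)).eval (∑ j, a j * t j)) *
        wcube κ t := by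
    rw [simpP, mul_assoc, ← MeasureTheory.integral_const_mul A]
    congr 2 with t
    rw [jacobi_eval_eq_gegen hl0 q hqdeg hqorth, zST]
    push_cast
    ring
  have hbound := hmain a ha0 ha1 n hn ρ hρ0 hρa.le
  rw [hP, abs_mul, ← Real.norm_eq_abs (∫ t in cube (d + 1), _), ← Complex.norm_real, hint,
    norm_mul, ← mul_assoc, ← hB]
  have hη : (n : ℝ)⁻¹ * ((n : ℝ)⁻¹ + ρ) = (n : ℝ)⁻¹ * ρ + ((n : ℝ) ^ 2)⁻¹ := by
    rw [← inv_pow]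
    ring
  have hfac : ((n : ℝ)⁻¹ * ((n : ℝ)⁻¹ + ρ)) ^ (-(l - ∑ j, κ j)) =
      (n : ℝ) ^ (((d : ℝ) - 1) / 2) * (ρ + (n : ℝ)⁻¹) ^ (-(((d : ℝ) - 1) / 2)) := by
    rw [hls, Real.mul_rpow (by positivity) (by positivity), Real.inv_rpow hn0.le,
      Real.rpow_neg hn0.le, inv_inv, add_comm]
  have hprod : ∏ j, ((n : ℝ)⁻¹ * ((n : ℝ)⁻¹ + ρ) + a j) ^ (-κ j) =
      ∏ j, (a j + (n : ℝ)⁻¹ * ρ + ((n : ℝ) ^ 2)⁻¹) ^ (-κ j) := by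
    refine Finset.prod_congr rfl fun j _ => ?_
    rw [hη]
    ring_nf
  rw [hfac, hprod] at hbound
  have hT : 0 ≤ (n : ℝ) ^ (((d : ℝ) - 1) / 2) * (ρ + (n : ℝ)⁻¹) ^ (-(((d : ℝ) - 1) / 2)) *
      ∏ j, (a j + (n : ℝ)⁻¹ * ρ + ((n : ℝ) ^ 2)⁻¹) ^ (-κ j) :=
    mul_nonneg (by positivity) (Finset.prod_nonneg fun j _ => by
      have := ha0 j
      positivity)
  calc _ ≤ B * (C * _) := mul_le_mul_of_nonneg_left hbound hB0
    _ ≤ (B * C + 1) * _ := by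
        rw [← mul_assoc]
        exact mul_le_mul_of_nonneg_right (by linarith) hT
    _ = _ := by
        simp only [ha, mul_assoc]
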